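/- arXiv:1304.0152 — 2 statements merged into one kernel-verified Lean document; each statement's English description precedes it below -/
import Mathlib

section
/- Let φ : X → Y be a Lipschitz map of metric spaces, k ≥ 0, and T ∈ D_k(X). Then the push-forward φ_#T belongs to D_k(Y), and ‖φ_#T‖ ≤ Lip(φ)^k · φ_#‖T‖ as Borel measures on Y (where φ_#‖T‖ is the image measure). Consequently φ_# : D_k(X) → D_k(Y) is Lipschitz with respect to the mass norms; if ‖T‖ is concentrated on a subset A ⊆ X then ‖φ_#T‖ is concentrated on φ(A); and if spt(T) is compact then spt(φ_#T) is compact. -/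
open MeasureTheory Metric Set Filter

noncomputable section

/-- `f : X → ℝ` is Lipschitz. -/
def IsLip {X : Type*} [PseudoMetricSpace X] (f : X → ℝ) : Prop :=
  ∃ K : NNReal, LipschitzWith K f

/-- `f : X → ℝ` is bounded and Lipschitz, i.e. `f ∈ Lip_b(X)`. -/
def IsLipBdd {X : Type*} [PseudoMetricSpace X] (f : X → ℝ) : Prop :=
  IsLip f ∧ ∃ C : ℝ, ∀ x, |f x| ≤ C

/-- The Lipschitz constant of a map. -/
def lipConst {X Y : Type*} [PseudoMetricSpace X] [PseudoMetricSpace Y] (f : X → Y) : NNReal :=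
  sInf {K : NNReal | LipschitzWith K f}

/-- The type carrying (k+1)-multilinear functionals on `D^k(X) = Lip_b(X) × Lip(X)^k`;
a functional is recorded by its values `T f π`. -/
abbrev Func (X : Type*) (k : ℕ) : Type _ := (X → ℝ) → (Fin k → X → ℝ) → ℝ

/-- `(f, π) ∈ D^k(X)`. -/
def InDomain {X : Type*} [PseudoMetricSpace X] {k : ℕ} (f : X → ℝ) (π : Fin k → X → ℝ) : Prop :=
  IsLipBdd f ∧ ∀ i, IsLip (π i)

/-- Two functionals agree as functionals on `D^k(X)`. -/
def DkEq {X : Type*} [PseudoMetricSpace X] {k : ℕ} (T T' : Func X k) : Prop :=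
  ∀ f π, InDomain f π → T f π = T' f π

/-- `T` is multilinear on `D^k(X)`: linear in the `Lip_b`-argument and in each
`Lip`-argument. -/
def IsMultilinear {X : Type*} [PseudoMetricSpace X] {k : ℕ} (T : Func X k) : Prop :=
  (∀ f g π, IsLipBdd f → IsLipBdd g → (∀ i, IsLip (π i)) → T (f + g) π = T f π + T g π) ∧
  (∀ (c : ℝ) f π, IsLipBdd f → (∀ i, IsLip (π i)) → T (c • f) π = c * T f π) ∧
  (∀ f π (i : Fin k) g g', IsLipBdd f → (∀ j, IsLip (π j)) → IsLip g → IsLip g' →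
    T f (Function.update π i (g + g')) =
      T f (Function.update π i g) + T f (Function.update π i g')) ∧
  (∀ f π (i : Fin k) (c : ℝ) g, IsLipBdd f → (∀ j, IsLip (π j)) → IsLip g →
    T f (Function.update π i (c • g)) = c * T f (Function.update π i g))

/-- A measure is tight if sets of small measure can be found outside compact sets. -/
def IsTightMeasure {X : Type*} [TopologicalSpace X] [MeasurableSpace X] (μ : Measure X) : Prop :=
  ∀ ε : ENNReal, 0 < ε → ∃ K : Set X, IsCompact K ∧ μ Kᶜ < ε

/-- The mass inequality `|T(f,π)| ≤ ∏ Lip(π_i) ∫ |f| dμ` for all `(f,π) ∈ D^k(X)`. -/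
def MassBound {X : Type*} [PseudoMetricSpace X] [MeasurableSpace X] {k : ℕ}
    (T : Func X k) (μ : Measure X) : Prop :=
  ∀ f π, InDomain f π → |T f π| ≤ (∏ i, (lipConst (π i) : ℝ)) * ∫ x, |f x| ∂μ

/-- The finite mass axiom: some finite *tight* Borel measure dominates `T`. -/
def HasFiniteMass {X : Type*} [PseudoMetricSpace X] [MeasurableSpace X] {k : ℕ}
    (T : Func X k) : Prop :=
  ∃ μ : Measure X, IsFiniteMeasure μ ∧ IsTightMeasure μ ∧ MassBound T μ

/-- `T ∈ D_k(X)`: a multilinear functional on `D^k(X)` with finite mass. -/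
def MemDk {X : Type*} [PseudoMetricSpace X] [MeasurableSpace X] {k : ℕ} (T : Func X k) : Prop :=
  IsMultilinear T ∧ HasFiniteMass T

/-- The mass measure `‖T‖`: the minimal finite Borel measure satisfying the mass bound. -/
def massMeasure {X : Type*} [PseudoMetricSpace X] [MeasurableSpace X] {k : ℕ}
    (T : Func X k) : Measure X :=
  sInf {μ : Measure X | IsFiniteMeasure μ ∧ MassBound T μ}

/-- The support of a measure: points all of whose balls have positive measure. -/
def msupport {X : Type*} [PseudoMetricSpace X] [MeasurableSpace X] (μ : Measure X) : Set X :=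
  {x | ∀ r : ℝ, 0 < r → 0 < μ (Metric.ball x r)}

/-- Push-forward of a functional along `φ`. -/
def pushF {X Y : Type*} {k : ℕ} (φ : X → Y) (T : Func X k) : Func Y k :=
  fun f π => T (f ∘ φ) (fun i => π i ∘ φ)

/-- Restriction `T⌊B` of a functional to a set `B`. -/
def restrF {X : Type*} {k : ℕ} (T : Func X k) (B : Set X) : Func X k :=
  fun f π => T (B.indicator f) π

/-- Locality: `T(f,π) = 0` if some `π_i` is constant on `{f ≠ 0}`. -/
def SatisfiesLocality {X : Type*} [PseudoMetricSpace X] {k : ℕ} (T : Func X k) : Prop :=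
  ∀ f π, InDomain f π →
    (∃ i : Fin k, ∀ x ∈ {y | f y ≠ 0}, ∀ x' ∈ {y | f y ≠ 0}, π i x = π i x') → T f π = 0

/-- Continuity: `T(f,π^j) → T(f,π)` if `π_i^j → π_i` pointwise with uniformly bounded
Lipschitz constants. -/
def SatisfiesContinuity {X : Type*} [PseudoMetricSpace X] {k : ℕ} (T : Func X k) : Prop :=
  ∀ (f : X → ℝ) (πs : ℕ → Fin k → X → ℝ) (π : Fin k → X → ℝ), IsLipBdd f →
    (∃ K : NNReal, ∀ j i, LipschitzWith K (πs j i)) → (∀ i, IsLip (π i)) →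
    (∀ i x, Tendsto (fun j => πs j i x) atTop (nhds (π i x))) →
    Tendsto (fun j => T f (πs j)) atTop (nhds (T f π))

/-- A `k`-current: an element of `D_k(X)` satisfying locality and continuity. -/
def IsCurrent {X : Type*} [PseudoMetricSpace X] [MeasurableSpace X] {k : ℕ}
    (T : Func X k) : Prop :=
  IsMultilinear T ∧ HasFiniteMass T ∧ SatisfiesLocality T ∧ SatisfiesContinuity T

/-- The boundary `∂T (f, π) = T(1, f, π)`. -/
def bdry {X : Type*} {k : ℕ} (T : Func X (k+1)) : Func X k :=
  fun f π => T (fun _ => (1:ℝ)) (Fin.cons f π)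

/-- Normality: `∂T` has finite mass (in degree `0` every functional is normal). -/
def IsNormal {X : Type*} [PseudoMetricSpace X] [MeasurableSpace X] :
    ∀ {k : ℕ}, Func X k → Prop
  | 0, _ => True
  | _ + 1, T => HasFiniteMass (bdry T)

/-- `T ∈ N_k^c(X)`: a normal current with compact support. -/
def MemNkc {X : Type*} [PseudoMetricSpace X] [MeasurableSpace X] {k : ℕ}
    (T : Func X k) : Prop :=
  IsCurrent T ∧ IsNormal T ∧ IsCompact (msupport (massMeasure T))


lemma auxIntegrable {X : Type*} [MetricSpace X] [MeasurableSpace X] [BorelSpace X]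
    {f : X → ℝ} (hf : IsLipBdd f) (μ : Measure X) [IsFiniteMeasure μ] :
    Integrable (fun x => |f x|) μ := by
  obtain ⟨⟨K, hK⟩, C, hC⟩ := hf
  refine Integrable.of_bound (C := C) hK.continuous.abs.aestronglyMeasurable ?_
  filter_upwards with x
  simpa using hC x

lemma auxLipConst {X Y : Type*} [MetricSpace X] [MetricSpace Y] {f : X → Y}
    (hf : ∃ K : NNReal, LipschitzWith K f) : LipschitzWith (lipConst f) f := by
  refine LipschitzWith.of_dist_le_mul fun x y => ?_
  have hne : {K : NNReal | LipschitzWith K f}.Nonempty := hf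
  rcases eq_or_lt_of_le (dist_nonneg (x := x) (y := y)) with h | h
  · have := hf.choose_spec.dist_le_mul x y
    rw [← h] at this ⊢
    simpa using this
  · rw [← div_le_iff₀ h]
    have : Real.toNNReal (dist (f x) (f y) / dist x y) ≤ lipConst f := by
      refine le_csInf hne fun K hK => ?_
      have := LipschitzWith.dist_le_mul hK x y
      rw [Real.toNNReal_le_iff_le_coe]
      exact (div_le_iff₀ h).2 this
    exact Real.toNNReal_le_iff_le_coe.1 this

lemma auxLipConst_le {X Y : Type*} [MetricSpace X] [MetricSpace Y] {f : X → Y} {K : NNReal}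
    (hf : LipschitzWith K f) : lipConst f ≤ K :=
  csInf_le (OrderBot.bddBelow _) hf

lemma auxMul {X : Type*} [MetricSpace X] {h f : X → ℝ} (hh : IsLipBdd h) (hf : IsLipBdd f) :
    IsLipBdd (fun x => h x * f x) := by
  obtain ⟨⟨K, hK⟩, C, hC⟩ := hh
  obtain ⟨⟨L, hL⟩, D, hD⟩ := hf
  refine ⟨⟨Real.toNNReal (|C| * L + |D| * K), LipschitzWith.of_dist_le_mul fun x y => ?_⟩,
    |C| * |D|, fun x => ?_⟩
  · rw [Real.coe_toNNReal _ (by positivity)]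
    have h1 := hK.dist_le_mul x y
    have h2 := hL.dist_le_mul x y
    rw [Real.dist_eq] at h1 h2 ⊢
    have e : h x * f x - h y * f y = h x * (f x - f y) + (h x - h y) * f y := by ring
    rw [e]
    calc _ ≤ |h x| * |f x - f y| + |h x - h y| * |f y| := by
            rw [← abs_mul, ← abs_mul]; exact abs_add_le _ _
      _ ≤ |C| * (L * dist x y) + (K * dist x y) * |D| := by
            have := (hC x).trans (le_abs_self C)
            have := (hD y).trans (le_abs_self D)
            gcongr
      _ = _ := by ring
  · rw [abs_mul]
    have := (hC x).trans (le_abs_self C)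
    have := (hD x).trans (le_abs_self D)
    gcongr

/-- approximation of bounds -/
lemma auxIntLe {X : Type*} [MetricSpace X] [MeasurableSpace X] [BorelSpace X]
    {f : X → ℝ} (hf : IsLipBdd f) {C : ℝ} (hC : ∀ x, |f x| ≤ C)
    (μ : Measure X) [IsFiniteMeasure μ] {ε : ℝ} (hε : 0 ≤ ε) (h0 : 0 ≤ C)
    (h : μ univ ≤ ENNReal.ofReal ε) :
    ∫ x, |f x| ∂μ ≤ C * ε := by
  calc ∫ x, |f x| ∂μ ≤ ∫ x, C ∂μ :=
        integral_mono (auxIntegrable hf μ) (integrable_const _) hC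
    _ = μ.real univ * C := by simp
    _ ≤ ε * C := by
        gcongr
        exact ENNReal.toReal_le_of_le_ofReal hε h
    _ = _ := mul_comm _ _

lemma auxGlueClosed {X : Type*} [MetricSpace X] [MeasurableSpace X] [BorelSpace X] {k : ℕ}
    {T : Func X k} (hT : IsMultilinear T) {μ ν : Measure X} [IsFiniteMeasure μ]
    [IsFiniteMeasure ν] (hμ : MassBound T μ) (hν : MassBound T ν) {F : Set X}
    (hF : IsClosed F) : MassBound T (μ.restrict F + ν.restrict Fᶜ) := by
  intro f π hfπ
  obtain ⟨hf, hπ⟩ := hfπ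
  have hδ : ∀ n : ℕ, (0 : ℝ) < 1 / ((n : ℝ) + 1) := fun n => by positivity
  set h : ℕ → X → ℝ := fun n x => (thickenedIndicator (hδ n) F x : ℝ) with hh
  have h01 : ∀ n x, 0 ≤ h n x ∧ h n x ≤ 1 := fun n x =>
    ⟨NNReal.coe_nonneg _, NNReal.coe_le_coe.2 (thickenedIndicator_le_one (hδ n) F x)⟩
  have hlip : ∀ n, ∃ K : NNReal, LipschitzWith K (h n) := fun n =>
    ⟨_, fun x y => lipschitzWith_thickenedIndicator (hδ n) F x y⟩
  have hb : ∀ n, IsLipBdd (h n) := fun n =>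
    ⟨hlip n, 1, fun x => abs_le.2 ⟨by linarith [(h01 n x).1], (h01 n x).2⟩⟩
  have hb' : ∀ n, IsLipBdd (fun x => 1 - h n x) := fun n => by
    obtain ⟨K, hK⟩ := hlip n
    refine ⟨⟨K, LipschitzWith.of_dist_le_mul fun x y => ?_⟩, 1, fun x => abs_le.2
      ⟨by linarith [(h01 n x).2], by linarith [(h01 n x).1]⟩⟩
    have := hK.dist_le_mul y x
    rw [Real.dist_eq, dist_comm] at this
    rw [Real.dist_eq]
    convert this using 2
    ring
  have hlim : ∀ x, Tendsto (fun n => h n x) atTop (nhds (F.indicator (fun _ => (1:ℝ)) x)) := by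
    intro x
    have := thickenedIndicator_tendsto_indicator_closure hδ
      tendsto_one_div_add_atTop_nhds_zero_nat F
    rw [tendsto_pi_nhds] at this
    have := (NNReal.tendsto_coe.2 (this x))
    rw [hF.closure_eq] at this
    convert this using 2
    by_cases hx : x ∈ F <;> simp [hx]
  set L : ℝ := ∏ i, (lipConst (π i) : ℝ) with hL
  have hbound : ∀ n, |T f π| ≤ L * (∫ x, h n x * |f x| ∂μ + ∫ x, (1 - h n x) * |f x| ∂ν) := by
    intro n
    have e : f = (fun x => h n x * f x) + (fun x => (1 - h n x) * f x) := by
      funext x; simp; ring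
    have h1 := hμ _ π ⟨auxMul (hb n) hf, hπ⟩
    have h2 := hν _ π ⟨auxMul (hb' n) hf, hπ⟩
    have e1 : ∀ x, |h n x * f x| = h n x * |f x| := fun x => by
      rw [abs_mul, abs_of_nonneg (h01 n x).1]
    have e2 : ∀ x, |(1 - h n x) * f x| = (1 - h n x) * |f x| := fun x => by
      rw [abs_mul, abs_of_nonneg (by linarith [(h01 n x).2])]
    simp only [e1] at h1
    simp only [e2] at h2
    have h3 := hT.1 _ _ π (auxMul (hb n) hf) (auxMul (hb' n) hf) hπ
    rw [← e] at h3
    rw [h3, mul_add]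
    exact (abs_add_le _ _).trans (add_le_add h1 h2)
  have hc : ∀ n, Continuous (h n) := fun n => (hlip n).choose_spec.continuous
  have hfc : Continuous f := hf.1.choose_spec.continuous
  have t1 : Tendsto (fun n => ∫ x, h n x * |f x| ∂μ) atTop
      (nhds (∫ x, F.indicator (fun _ => (1:ℝ)) x * |f x| ∂μ)) := by
    refine tendsto_integral_of_dominated_convergence (fun x => |f x|)
      (fun n => ((hc n).mul hfc.abs).aestronglyMeasurable) (auxIntegrable hf μ) ?_ ?_
    · intro n
      filter_upwards with x
      rw [Real.norm_eq_abs, abs_mul, abs_abs, abs_of_nonneg (h01 n x).1]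
      exact mul_le_of_le_one_left (abs_nonneg _) (h01 n x).2
    · filter_upwards with x
      exact (hlim x).mul_const _
  have t2 : Tendsto (fun n => ∫ x, (1 - h n x) * |f x| ∂ν) atTop
      (nhds (∫ x, (1 - F.indicator (fun _ => (1:ℝ)) x) * |f x| ∂ν)) := by
    refine tendsto_integral_of_dominated_convergence (fun x => |f x|)
      (fun n => ((continuous_const.sub (hc n)).mul hfc.abs).aestronglyMeasurable)
      (auxIntegrable hf ν) ?_ ?_
    · intro n
      filter_upwards with x
      rw [Real.norm_eq_abs, abs_mul, abs_abs, abs_of_nonneg (by linarith [(h01 n x).2])]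
      exact mul_le_of_le_one_left (abs_nonneg _) (by linarith [(h01 n x).1])
    · filter_upwards with x
      exact ((hlim x).const_sub 1).mul_const _
  have := ge_of_tendsto' ((t1.add t2).const_mul L) hbound
  rw [integral_add_measure (auxIntegrable hf _) (auxIntegrable hf _),
    ← integral_indicator hF.measurableSet, ← integral_indicator hF.measurableSet.compl]
  have e1 : F.indicator (fun x => |f x|) =
      fun x => F.indicator (fun _ => (1:ℝ)) x * |f x| := by
    funext x
    by_cases hx : x ∈ F <;> simp [hx]
  have e2 : Fᶜ.indicator (fun x => |f x|) =
      fun x => (1 - F.indicator (fun _ => (1:ℝ)) x) * |f x| := by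
    funext x
    by_cases hx : x ∈ F <;> simp [hx]
  rw [e1, e2]
  exact this

lemma auxGlue {X : Type*} [MetricSpace X] [MeasurableSpace X] [BorelSpace X] {k : ℕ}
    {T : Func X k} (hT : IsMultilinear T) {μ ν : Measure X} [IsFiniteMeasure μ]
    [IsFiniteMeasure ν] (hμ : MassBound T μ) (hν : MassBound T ν) {B : Set X}
    (hB : MeasurableSet B) : MassBound T (μ.restrict B + ν.restrict Bᶜ) := by
  intro f π hfπ
  obtain ⟨C, hC⟩ := hfπ.1.2
  set L : ℝ := ∏ i, (lipConst (π i) : ℝ) with hL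
  have hL0 : 0 ≤ L := Finset.prod_nonneg fun i _ => NNReal.coe_nonneg _
  have key : ∀ ε : ℝ, 0 < ε → |T f π| ≤
      L * ((∫ x, |f x| ∂(μ.restrict B + ν.restrict Bᶜ)) + |C| * ε) := by
    intro ε hε
    obtain ⟨F, hFB, hF, hlt⟩ := hB.exists_isClosed_sdiff_lt (μ := ν) (measure_ne_top _ _)
      (ENNReal.ofReal_pos.2 hε).ne'
    refine (auxGlueClosed hT hμ hν hF f π hfπ).trans ?_
    refine mul_le_mul_of_nonneg_left ?_ hL0
    have hle : μ.restrict F + ν.restrict Fᶜ ≤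
        (μ.restrict B + ν.restrict Bᶜ) + ν.restrict (B \ F) := by
      have e : Fᶜ = Bᶜ ∪ (B \ F) := by
        ext x
        have := @hFB x
        simp only [mem_compl_iff, mem_union, Set.mem_sdiff]
        tauto
      rw [add_assoc]
      refine add_le_add (Measure.restrict_mono hFB le_rfl) ?_
      rw [e]
      exact Measure.restrict_union_le _ _
    calc _ ≤ ∫ x, |f x| ∂((μ.restrict B + ν.restrict Bᶜ) + ν.restrict (B \ F)) :=
          integral_mono_measure hle (ae_of_all _ fun x => abs_nonneg _) (auxIntegrable hfπ.1 _)
      _ = _ := integral_add_measure (auxIntegrable hfπ.1 _) (auxIntegrable hfπ.1 _)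
      _ ≤ _ := by
          gcongr
          refine auxIntLe hfπ.1 (fun x => (hC x).trans (le_abs_self C)) _ hε.le (abs_nonneg _) ?_
          simpa using hlt.le
  have hlim : Tendsto (fun ε : ℝ => L * ((∫ x, |f x| ∂(μ.restrict B + ν.restrict Bᶜ)) + |C| * ε))
      (nhdsWithin 0 (Ioi 0)) (nhds
        (L * ((∫ x, |f x| ∂(μ.restrict B + ν.restrict Bᶜ)) + |C| * 0))) := by
    refine Tendsto.mono_left (Continuous.tendsto (by fun_prop) 0) nhdsWithin_le_nhds
  have := ge_of_tendsto hlim (by filter_upwards [self_mem_nhdsWithin] with ε hε using key ε hε)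
  simpa using this

lemma auxApprox {X : Type*} [MetricSpace X] [MeasurableSpace X] [BorelSpace X] {k : ℕ}
    {T : Func X k} (hT : IsMultilinear T) {μ₀ : Measure X} [IsFiniteMeasure μ₀]
    (hμ₀ : MassBound T μ₀) {ε : ENNReal} (hε : ε ≠ 0) :
    ∃ ν : Measure X, IsFiniteMeasure ν ∧ MassBound T ν ∧
      ν univ ≤ massMeasure T univ + ε := by
  set S : Set (Measure X) := {μ : Measure X | IsFiniteMeasure μ ∧ MassBound T μ} with hS
  have hε2 : ε / 2 ≠ 0 := (ENNReal.div_pos hε (by simp)).ne'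
  have hε4 : ε / 2 / 2 ≠ 0 := (ENNReal.div_pos hε2 (by simp)).ne'
  have hfin : massMeasure T univ ≠ ⊤ :=
    ne_top_of_le_ne_top (measure_ne_top μ₀ univ) (sInf_le (show μ₀ ∈ S from ⟨‹_›, hμ₀⟩) univ)
  have h1 : massMeasure T univ < massMeasure T univ + ε / 2 / 2 := ENNReal.lt_add_right hfin hε4
  have hne : (Measure.toOuterMeasure '' S).Nonempty := ⟨_, μ₀, ⟨‹_›, hμ₀⟩, rfl⟩
  conv_lhs at h1 => rw [massMeasure, Measure.sInf_apply MeasurableSet.univ,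
    OuterMeasure.sInf_apply hne]
  simp only [iInf_lt_iff] at h1
  obtain ⟨t, ht, hlt⟩ := h1
  obtain ⟨δ, hδ0, hδ⟩ := ENNReal.exists_pos_sum_of_countable hε4 ℕ
  have hne_top : (∑' n, ⨅ (μ : OuterMeasure X) (_ : μ ∈ Measure.toOuterMeasure '' S), μ (t n))
      ≠ ⊤ := (lt_top_iff_ne_top.1 (hlt.trans_le le_top))
  have hch : ∀ n, ∃ μ ∈ S, μ (t n) ≤
      (⨅ (μ : OuterMeasure X) (_ : μ ∈ Measure.toOuterMeasure '' S), μ (t n)) + δ n := by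
    intro n
    have : (⨅ (μ : OuterMeasure X) (_ : μ ∈ Measure.toOuterMeasure '' S), μ (t n)) <
      (⨅ (μ : OuterMeasure X) (_ : μ ∈ Measure.toOuterMeasure '' S), μ (t n)) + δ n :=
      ENNReal.lt_add_right (ENNReal.ne_top_of_tsum_ne_top hne_top n) (by simpa using (hδ0 n).ne')
    conv_lhs at this => rw [iInf_image]
    simp only [iInf_lt_iff] at this
    obtain ⟨μ, hμ, h⟩ := this
    exact ⟨μ, hμ, h.le⟩
  choose μ hμS hμt using hch
  let t' : ℕ → Set X := fun n => toMeasurable (μ n) (t n)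
  have ht'm : ∀ n, MeasurableSet (t' n) := fun n => measurableSet_toMeasurable _ _
  have hcov : ⋃ n, t' n = univ := by
    refine eq_univ_of_univ_subset (ht.trans (iUnion_mono fun n => subset_toMeasurable _ _))
  have hsum : ∑' n, μ n (t' n) ≤ massMeasure T univ + ε / 2 := by
    calc ∑' n, μ n (t' n) ≤ ∑' n, ((⨅ (μ : OuterMeasure X)
          (_ : μ ∈ Measure.toOuterMeasure '' S), μ (t n)) + δ n) := by
          refine ENNReal.tsum_le_tsum fun n => ?_
          rw [measure_toMeasurable]
          exact hμt n
      _ ≤ massMeasure T univ + ε / 2 / 2 + ε / 2 / 2 := by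
          rw [ENNReal.tsum_add]
          exact add_le_add hlt.le hδ.le
      _ = _ := by rw [add_assoc, ENNReal.add_halves]
  have hind : ∀ N : ℕ, ∃ ν : Measure X, IsFiniteMeasure ν ∧ MassBound T ν ∧
      ∀ A, MeasurableSet A → ν A ≤ ∑ n ∈ Finset.range N, μ n (t' n) +
        μ₀ (A \ ⋃ n ∈ Finset.range N, t' n) := by
    intro N
    induction N with
    | zero => exact ⟨μ₀, ‹_›, hμ₀, fun A _ => by simp⟩
    | succ N ih =>
      obtain ⟨ν, hν, hb, hA⟩ := ih
      have := (hμS N).1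
      refine ⟨(μ N).restrict (t' N) + ν.restrict (t' N)ᶜ, inferInstance,
        auxGlue hT (hμS N).2 hb (ht'm N), fun A hAm => ?_⟩
      rw [Measure.add_apply, Measure.restrict_apply hAm, Measure.restrict_apply hAm,
        Finset.sum_range_succ]
      have e : A \ ⋃ n ∈ Finset.range (N + 1), t' n =
          (A ∩ (t' N)ᶜ) \ ⋃ n ∈ Finset.range N, t' n := by
        rw [Finset.range_add_one, Finset.set_biUnion_insert]
        ext x
        simp only [Set.mem_sdiff, mem_union, mem_inter_iff, mem_compl_iff]
        tauto
      rw [e]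
      calc _ ≤ μ N (t' N) + (∑ n ∈ Finset.range N, μ n (t' n) +
            μ₀ ((A ∩ (t' N)ᶜ) \ ⋃ n ∈ Finset.range N, t' n)) :=
            add_le_add (measure_mono inter_subset_right) (hA _ (hAm.inter (ht'm N).compl))
        _ = _ := by ring
  have hlim : Tendsto (μ₀ ∘ fun N : ℕ => univ \ ⋃ n ∈ Finset.range N, t' n) atTop
      (nhds (μ₀ (⋂ N : ℕ, univ \ ⋃ n ∈ Finset.range N, t' n))) := by
    refine tendsto_measure_iInter_atTop (fun N => ?_) ?_ ⟨0, measure_ne_top _ _⟩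
    · exact (MeasurableSet.univ.diff (Finset.measurableSet_biUnion _
        fun n _ => ht'm n)).nullMeasurableSet
    · intro a b hab
      refine sdiff_subset_sdiff_right (biUnion_subset_biUnion_left ?_)
      intro n hn
      simp only [Finset.coe_range, mem_Iio, Finset.mem_range] at hn ⊢
      exact lt_of_lt_of_le (by simpa using hn) hab
  have hemp : (⋂ N : ℕ, univ \ ⋃ n ∈ Finset.range N, t' n) = ∅ := by
    rw [eq_empty_iff_forall_notMem]
    intro x hx
    have hx' : x ∈ ⋃ n, t' n := hcov ▸ mem_univ x
    obtain ⟨n, hn⟩ := mem_iUnion.1 hx'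
    have := (mem_iInter.1 hx (n + 1)).2
    exact this (mem_biUnion (x := n) (by simp) hn)
  rw [hemp, measure_empty] at hlim
  obtain ⟨N, hN⟩ := (hlim.eventually_lt_const (pos_iff_ne_zero.2 hε2)).exists
  obtain ⟨ν, hν, hb, hA⟩ := hind N
  refine ⟨ν, hν, hb, (hA univ MeasurableSet.univ).trans ?_⟩
  calc _ ≤ (massMeasure T univ + ε / 2) + ε / 2 :=
        add_le_add ((ENNReal.sum_le_tsum _).trans hsum) hN.le
    _ = _ := by rw [add_assoc, ENNReal.add_halves]

lemma auxMass {X : Type*} [MetricSpace X] [MeasurableSpace X] [BorelSpace X] {k : ℕ}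
    {T : Func X k} (hT : MemDk T) :
    IsFiniteMeasure (massMeasure T) ∧ IsTightMeasure (massMeasure T) ∧
      MassBound T (massMeasure T) := by
  obtain ⟨hm, μ₀, hfin, htight, hb₀⟩ := hT
  have hle : massMeasure T ≤ μ₀ := sInf_le (show μ₀ ∈ {μ : Measure X | _} from ⟨‹_›, hb₀⟩)
  have hfm : IsFiniteMeasure (massMeasure T) := ⟨(hle univ).trans_lt (measure_lt_top _ _)⟩
  refine ⟨hfm, fun ε hε => ?_, fun f π hfπ => ?_⟩
  · obtain ⟨K, hK, h⟩ := htight ε hε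
    exact ⟨K, hK, (hle _).trans_lt h⟩
  obtain ⟨C, hC⟩ := hfπ.1.2
  set L : ℝ := ∏ i, (lipConst (π i) : ℝ) with hL
  have hL0 : 0 ≤ L := Finset.prod_nonneg fun i _ => NNReal.coe_nonneg _
  have key : ∀ ε : ℝ, 0 < ε → |T f π| ≤
      L * ((∫ x, |f x| ∂(massMeasure T)) + |C| * ε) := by
    intro ε hε
    obtain ⟨ν, hν, hνb, hνε⟩ := auxApprox hm hb₀ (ENNReal.ofReal_pos.2 hε).ne'
    refine (hνb f π hfπ).trans (mul_le_mul_of_nonneg_left ?_ hL0)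
    have hle' : massMeasure T ≤ ν := sInf_le (show ν ∈ {μ : Measure X | _} from ⟨‹_›, hνb⟩)
    have e := Measure.sub_add_cancel_of_le hle'
    have : IsFiniteMeasure (ν - massMeasure T) := inferInstance
    have hsub : (ν - massMeasure T) univ ≤ ENNReal.ofReal ε := by
      rw [Measure.sub_apply MeasurableSet.univ hle']
      exact tsub_le_iff_left.2 hνε
    rw [← e, integral_add_measure (auxIntegrable hfπ.1 _) (auxIntegrable hfπ.1 _), add_comm]
    gcongr
    exact auxIntLe hfπ.1 (fun x => (hC x).trans (le_abs_self C)) _ hε.le (abs_nonneg _) hsub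
  have hlim : Tendsto (fun ε : ℝ => L * ((∫ x, |f x| ∂(massMeasure T)) + |C| * ε))
      (nhdsWithin 0 (Ioi 0)) (nhds
        (L * ((∫ x, |f x| ∂(massMeasure T)) + |C| * 0))) := by
    refine Tendsto.mono_left (Continuous.tendsto (by fun_prop) 0) nhdsWithin_le_nhds
  have := ge_of_tendsto hlim (by filter_upwards [self_mem_nhdsWithin] with ε hε using key ε hε)
  simpa using this

lemma auxCompLip {X Y : Type*} [MetricSpace X] [MetricSpace Y] {φ : X → Y}
    (hφ : ∃ K : NNReal, LipschitzWith K φ) {g : Y → ℝ} (hg : IsLip g) : IsLip (g ∘ φ) := by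
  obtain ⟨K, hK⟩ := hφ
  obtain ⟨L, hL⟩ := hg
  exact ⟨_, hL.comp hK⟩

lemma auxCompLipBdd {X Y : Type*} [MetricSpace X] [MetricSpace Y] {φ : X → Y}
    (hφ : ∃ K : NNReal, LipschitzWith K φ) {g : Y → ℝ} (hg : IsLipBdd g) :
    IsLipBdd (g ∘ φ) := by
  obtain ⟨hg, C, hC⟩ := hg
  exact ⟨auxCompLip hφ hg, C, fun x => hC _⟩

lemma auxPushMultilinear {X Y : Type*} [MetricSpace X] [MetricSpace Y] {k : ℕ} {φ : X → Y}
    (hφ : ∃ K : NNReal, LipschitzWith K φ) {T : Func X k} (hT : IsMultilinear T) :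
    IsMultilinear (pushF φ T) := by
  have hu : ∀ (π : Fin k → Y → ℝ) (i : Fin k) (g : Y → ℝ),
      (fun j => Function.update π i g j ∘ φ) =
        Function.update (fun j => π j ∘ φ) i (g ∘ φ) := by
    intro π i g
    funext j
    by_cases h : j = i
    · subst h; simp
    · simp [h]
  refine ⟨fun f g π hf hg hπ => ?_, fun c f π hf hπ => ?_, fun f π i g g' hf hπ hg hg' => ?_,
    fun f π i c g hf hπ hg => ?_⟩
  · exact hT.1 _ _ _ (auxCompLipBdd hφ hf) (auxCompLipBdd hφ hg) fun i => auxCompLip hφ (hπ i)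
  · exact hT.2.1 c _ _ (auxCompLipBdd hφ hf) fun i => auxCompLip hφ (hπ i)
  · simp only [pushF, hu]
    exact hT.2.2.1 _ _ i _ _ (auxCompLipBdd hφ hf) (fun i => auxCompLip hφ (hπ i))
      (auxCompLip hφ hg) (auxCompLip hφ hg')
  · simp only [pushF, hu]
    exact hT.2.2.2 _ _ i c _ (auxCompLipBdd hφ hf) (fun i => auxCompLip hφ (hπ i))
      (auxCompLip hφ hg)

lemma auxPushBound {X Y : Type*} [MetricSpace X] [MeasurableSpace X] [BorelSpace X]
    [MetricSpace Y] [MeasurableSpace Y] [BorelSpace Y] {k : ℕ}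
    {φ : X → Y} (hφ : ∃ K : NNReal, LipschitzWith K φ) {T : Func X k} {μ : Measure X}
    (hμ : MassBound T μ) :
    MassBound (pushF φ T) (((lipConst φ : ENNReal) ^ k) • μ.map φ) := by
  intro f π hfπ
  have hcont : Continuous φ := hφ.choose_spec.continuous
  have h := hμ (f ∘ φ) (fun i => π i ∘ φ)
    ⟨auxCompLipBdd hφ hfπ.1, fun i => auxCompLip hφ (hfπ.2 i)⟩
  have hfc : Continuous f := hfπ.1.1.choose_spec.continuous
  rw [integral_smul_measure, integral_map hcont.aemeasurable hfc.abs.aestronglyMeasurable]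
  refine h.trans ?_
  have hi : 0 ≤ ∫ x, |(f ∘ φ) x| ∂μ := integral_nonneg fun x => abs_nonneg _
  calc _ ≤ (∏ i, ((lipConst (π i) : ℝ) * (lipConst φ : ℝ))) * ∫ x, |(f ∘ φ) x| ∂μ := by
        refine mul_le_mul_of_nonneg_right (Finset.prod_le_prod
          (fun i _ => NNReal.coe_nonneg _) fun i _ => ?_) hi
        exact_mod_cast auxLipConst_le ((auxLipConst (hfπ.2 i)).comp (auxLipConst hφ))
    _ = _ := by
        rw [Finset.prod_mul_distrib]
        simp [mul_assoc]

lemma auxPushMass {X Y : Type*} [MetricSpace X] [MeasurableSpace X] [BorelSpace X]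
    [MetricSpace Y] [MeasurableSpace Y] [BorelSpace Y] {k : ℕ}
    {φ : X → Y} (hφ : ∃ K : NNReal, LipschitzWith K φ) {T : Func X k} (hT : MemDk T) :
    massMeasure (pushF φ T) ≤ ((lipConst φ : ENNReal) ^ k) • (massMeasure T).map φ := by
  obtain ⟨h1, _, h3⟩ := auxMass hT
  refine sInf_le ⟨?_, auxPushBound hφ h3⟩
  exact Measure.smul_finite _ (by finiteness)

lemma auxSub {X : Type*} [MetricSpace X] [MeasurableSpace X] [BorelSpace X] {k : ℕ}
    {T T' : Func X k} (hT : MemDk T) (hT' : MemDk T') : MemDk (T - T') := by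
  obtain ⟨⟨a1, a2, a3, a4⟩, μ, hμ, ht, hb⟩ := hT
  obtain ⟨⟨b1, b2, b3, b4⟩, ν, hν, ht', hb'⟩ := hT'
  refine ⟨⟨fun f g π hf hg hπ => ?_, fun c f π hf hπ => ?_, fun f π i g g' hf hπ hg hg' => ?_,
    fun f π i c g hf hπ hg => ?_⟩, μ + ν, inferInstance, fun ε hε => ?_, fun f π hfπ => ?_⟩
  · simp only [Pi.sub_apply, a1 f g π hf hg hπ, b1 f g π hf hg hπ]; ring
  · simp only [Pi.sub_apply, a2 c f π hf hπ, b2 c f π hf hπ]; ring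
  · simp only [Pi.sub_apply, a3 f π i g g' hf hπ hg hg', b3 f π i g g' hf hπ hg hg']; ring
  · simp only [Pi.sub_apply, a4 f π i c g hf hπ hg, b4 f π i c g hf hπ hg]; ring
  · obtain ⟨K, hK, h⟩ := ht (ε / 2) (ENNReal.half_pos hε.ne')
    obtain ⟨K', hK', h'⟩ := ht' (ε / 2) (ENNReal.half_pos hε.ne')
    refine ⟨K ∪ K', hK.union hK', ?_⟩
    rw [Measure.add_apply, ← ENNReal.add_halves ε]
    refine ENNReal.add_lt_add (lt_of_le_of_lt (measure_mono ?_) h)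
      (lt_of_le_of_lt (measure_mono ?_) h')
    · exact compl_subset_compl.2 subset_union_left
    · exact compl_subset_compl.2 subset_union_right
  · rw [integral_add_measure (auxIntegrable hfπ.1 _) (auxIntegrable hfπ.1 _), mul_add]
    exact (abs_sub _ _).trans (add_le_add (hb f π hfπ) (hb' f π hfπ))

lemma auxConc {X Y : Type*} [MetricSpace X] [MeasurableSpace X] [BorelSpace X]
    [MetricSpace Y] [MeasurableSpace Y] [BorelSpace Y]
    {φ : X → Y} (hφ : Continuous φ) {m : Measure X} [IsFiniteMeasure m]
    (ht : IsTightMeasure m) {A : Set X} (hA : m Aᶜ = 0) : m.map φ (φ '' A)ᶜ = 0 := by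
  obtain ⟨N, hAN, hN, hN0⟩ := exists_measurable_superset_of_null hA
  have hsub : Nᶜ ⊆ A := compl_subset_comm.1 hAN
  refine le_antisymm (le_of_forall_pos_le_add fun ε hε => ?_) bot_le
  rw [zero_add]
  have hε2 := ENNReal.half_pos hε.ne'
  obtain ⟨K, hK, hKε⟩ := ht (ε / 2) hε2
  obtain ⟨F, hFN, hF, hFε⟩ := hN.compl.exists_isClosed_sdiff_lt (μ := m) (measure_ne_top _ _)
    hε2.ne'
  have hc : IsCompact (φ '' (K ∩ F)) := (hK.inter_right hF).image hφ
  calc m.map φ (φ '' A)ᶜ ≤ m.map φ (φ '' (K ∩ F))ᶜ :=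
        measure_mono (compl_subset_compl.2 (image_mono
          (inter_subset_right.trans (hFN.trans hsub))))
    _ = m (φ ⁻¹' (φ '' (K ∩ F))ᶜ) :=
        Measure.map_apply hφ.measurable hc.measurableSet.compl
    _ ≤ m (Kᶜ ∪ (N ∪ (Nᶜ \ F))) := by
        refine measure_mono fun x hx => ?_
        have : x ∉ K ∩ F := fun h => hx ⟨x, h, rfl⟩
        simp only [mem_inter_iff, mem_union, mem_compl_iff, Set.mem_sdiff] at this ⊢
        tauto
    _ ≤ m Kᶜ + (m N + m (Nᶜ \ F)) :=
        (measure_union_le _ _).trans (add_le_add le_rfl (measure_union_le _ _))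
    _ ≤ ε / 2 + (0 + ε / 2) := by
        gcongr
        exact hN0.le
    _ = ε := by rw [zero_add, ENNReal.add_halves]

lemma auxSupp {X : Type*} [MetricSpace X] [MeasurableSpace X] [BorelSpace X]
    {m : Measure X} (ht : IsTightMeasure m) : m (msupport m)ᶜ = 0 := by
  have hnull : ∀ x ∈ (msupport m)ᶜ, ∃ r : ℝ, 0 < r ∧ m (ball x r) = 0 := by
    intro x hx
    simp only [msupport, mem_compl_iff, mem_ofPred_eq, not_forall, not_lt] at hx
    obtain ⟨r, hr, h⟩ := hx
    exact ⟨r, hr, le_antisymm h bot_le⟩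
  refine le_antisymm (le_of_forall_pos_le_add fun ε hε => ?_) bot_le
  rw [zero_add]
  obtain ⟨K, hK, hKε⟩ := ht ε hε
  have h0 : m ((msupport m)ᶜ ∩ K) = 0 := by
    have hsep : TopologicalSpace.IsSeparable ((msupport m)ᶜ ∩ K) :=
      hK.isSeparable.mono inter_subset_right
    choose! r hr h0 using hnull
    have : SecondCountableTopology ((msupport m)ᶜ ∩ K : Set X) := hsep.secondCountableTopology
    obtain ⟨s, hs, hsU⟩ := TopologicalSpace.isOpen_iUnion_countable
      (fun x : ((msupport m)ᶜ ∩ K : Set X) =>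
        ((↑) : ((msupport m)ᶜ ∩ K : Set X) → X) ⁻¹' (ball x.1 (r x.1)))
      (fun x => isOpen_ball.preimage continuous_subtype_val)
    have hcov : (msupport m)ᶜ ∩ K ⊆ ⋃ x ∈ s, ball (x : X) (r x) := by
      intro x hx
      have : (⟨x, hx⟩ : ((msupport m)ᶜ ∩ K : Set X)) ∈ ⋃ x : ((msupport m)ᶜ ∩ K : Set X),
        ((↑) : ((msupport m)ᶜ ∩ K : Set X) → X) ⁻¹' (ball x.1 (r x.1)) :=
        mem_iUnion.2 ⟨⟨x, hx⟩, mem_ball_self (hr x hx.1)⟩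
      rw [← hsU] at this
      obtain ⟨y, hy, hxy⟩ := mem_iUnion₂.1 this
      exact mem_iUnion₂.2 ⟨y, hy, hxy⟩
    exact measure_mono_null hcov ((measure_biUnion_null_iff hs).2 fun x _ => h0 x x.2.1)
  calc m (msupport m)ᶜ ≤ m (((msupport m)ᶜ ∩ K) ∪ Kᶜ) := measure_mono fun x hx => by
        by_cases h : x ∈ K
        · exact Or.inl ⟨hx, h⟩
        · exact Or.inr h
    _ ≤ 0 + ε := (measure_union_le _ _).trans (add_le_add h0.le hKε.le)
    _ = ε := zero_add _

lemma auxSuppSub {X : Type*} [MetricSpace X] [MeasurableSpace X]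
    {m : Measure X} {C : Set X} (hC : IsCompact C) (h : m Cᶜ = 0) :
    IsCompact (msupport m) := by
  refine hC.of_isClosed_subset ?_ ?_
  · rw [← isOpen_compl_iff, Metric.isOpen_iff]
    intro x hx
    simp only [msupport, mem_compl_iff, mem_ofPred_eq, not_forall, not_lt] at hx
    obtain ⟨r, hr, h⟩ := hx
    refine ⟨r / 2, by positivity, fun y hy hy' => ?_⟩
    have := hy' (r / 2) (by positivity)
    refine absurd ((measure_mono (ball_subset_ball' ?_)).trans h) (not_le.2 this)
    have := mem_ball.1 hy
    linarith
  · intro x hx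
    by_contra hxC
    obtain ⟨r, hr, hsub⟩ := Metric.isOpen_iff.1 hC.isClosed.isOpen_compl x hxC
    exact absurd (measure_mono_null hsub h) (hx r hr).ne'

/-- Push-forward along a Lipschitz map `φ : X → Y`: for `T ∈ D_k(X)`, `φ_#T ∈ D_k(Y)` with
`‖φ_#T‖ ≤ Lip(φ)^k ⬝ φ_#‖T‖`; consequently `φ_# : D_k(X) → D_k(Y)` is Lipschitz for the
mass norms, concentration is preserved (`‖T‖` concentrated on `A` implies `‖φ_#T‖`
concentrated on `φ(A)`), and compactness of supports is preserved. -/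
theorem pushF_mem_dk {X Y : Type*} [MetricSpace X] [MeasurableSpace X] [BorelSpace X]
    [MetricSpace Y] [MeasurableSpace Y] [BorelSpace Y] {k : ℕ}
    (φ : X → Y) (hφ : ∃ K : NNReal, LipschitzWith K φ)
    (T : Func X k) (hT : MemDk T) :
    MemDk (pushF φ T) ∧
    massMeasure (pushF φ T) ≤ ((lipConst φ : ENNReal) ^ k) • (massMeasure T).map φ ∧
    (∀ T' : Func X k, MemDk T' →
      massMeasure (pushF φ T - pushF φ T') Set.univ ≤
        ((lipConst φ : ENNReal) ^ k) * massMeasure (T - T') Set.univ) ∧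
    (∀ A : Set X, massMeasure T Aᶜ = 0 → massMeasure (pushF φ T) (φ '' A)ᶜ = 0) ∧
    (IsCompact (msupport (massMeasure T)) →
      IsCompact (msupport (massMeasure (pushF φ T)))) := by
  obtain ⟨hfin, htight, hbound⟩ := auxMass hT
  have hcont : Continuous φ := hφ.choose_spec.continuous
  have hle := auxPushMass hφ hT
  have hconc : ∀ A : Set X, massMeasure T Aᶜ = 0 →
      massMeasure (pushF φ T) (φ '' A)ᶜ = 0 := by
    intro A hA
    refine le_antisymm ((hle _).trans ?_) bot_le
    rw [Measure.smul_apply, auxConc hcont htight hA]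
    simp
  refine ⟨⟨auxPushMultilinear hφ hT.1, _, Measure.smul_finite _ ?_, fun ε hε => ?_,
    auxPushBound hφ hbound⟩, hle, fun T' hT' => ?_, hconc, fun hc => ?_⟩
  · finiteness
  · have hc : (lipConst φ : ENNReal) ^ k ≠ ⊤ := by finiteness
    obtain ⟨K, hK, hKε⟩ := htight (ε / ((lipConst φ : ENNReal) ^ k))
      (ENNReal.div_pos hε.ne' hc)
    refine ⟨φ '' K, hK.image hcont, ?_⟩
    rw [Measure.smul_apply, Measure.map_apply hcont.measurable
      (hK.image hcont).measurableSet.compl, smul_eq_mul]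
    have hsub : massMeasure T (φ ⁻¹' (φ '' K)ᶜ) ≤ massMeasure T Kᶜ :=
      measure_mono fun x hx hxK => hx ⟨x, hxK, rfl⟩
    rw [mul_comm]
    exact ENNReal.mul_lt_of_lt_div (hsub.trans_lt hKε)
  · have h := auxPushMass hφ (auxSub hT hT') univ
    rw [Measure.smul_apply, Measure.map_apply hcont.measurable MeasurableSet.univ,
      preimage_univ, smul_eq_mul] at h
    exact h
  · exact auxSuppSub (hc.image hcont) (hconc _ (auxSupp htight))
end
end

section
/- Let X be a metric space, A ⊆ X a subset with the restricted metric, ι : A → X the inclusion, k ≥ 0, and T ∈ N_k^c(X). Then T lies in the image ι_#(N_k^c(A)) if and only if spt(T) ⊆ A. -/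
open MeasureTheory Metric Set Filter

noncomputable section

open Topology

section basics
variable {X : Type*} [PseudoMetricSpace X]

lemma lipschitz_lipConst {f : X → ℝ} (h : IsLip f) : LipschitzWith (lipConst f) f := by
  obtain ⟨K, hK⟩ := h
  refine LipschitzWith.of_dist_le_mul fun x y => ?_
  have hne : {K : NNReal | LipschitzWith K f}.Nonempty := ⟨K, hK⟩
  by_contra hcon
  push Not at hcon
  have hd : 0 < dist x y := by
    rcases (dist_nonneg (x := x) (y := y)).eq_or_lt with h0 | h0
    · have := hK.dist_le_mul x y
      rw [← h0] at this hcon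
      simp at this hcon
      exact absurd this hcon
    · exact h0
  have h1 : (lipConst f : ℝ) < dist (f x) (f y) / dist x y := by
    rwa [lt_div_iff₀ hd]
  have h2 : lipConst f < (dist (f x) (f y) / dist x y).toNNReal := by
    rw [← NNReal.coe_lt_coe, Real.coe_toNNReal _ (by positivity)]
    exact h1
  obtain ⟨L, hL, hlt⟩ := exists_lt_of_csInf_lt hne h2
  have h3 := LipschitzWith.dist_le_mul (K := L) (f := f) hL x y
  rw [← NNReal.coe_lt_coe, Real.coe_toNNReal _ (by positivity), lt_div_iff₀ hd] at hlt
  linarith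

lemma lipConst_le {f : X → ℝ} {K : NNReal} (h : LipschitzWith K f) : lipConst f ≤ K :=
  csInf_le (OrderBot.bddBelow _) h

lemma IsLip.add {f g : X → ℝ} (hf : IsLip f) (hg : IsLip g) : IsLip (f + g) := by
  obtain ⟨K, hK⟩ := hf
  obtain ⟨L, hL⟩ := hg
  exact ⟨K + L, hK.add hL⟩

lemma isLip_const (c : ℝ) : IsLip (fun _ : X => c) := ⟨0, LipschitzWith.const c⟩

lemma isLipBdd_const (c : ℝ) : IsLipBdd (fun _ : X => c) := ⟨isLip_const c, |c|, fun _ => le_rfl⟩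

lemma IsLip.smul {f : X → ℝ} (c : ℝ) (hf : IsLip f) : IsLip (c • f) := by
  obtain ⟨K, hK⟩ := hf
  refine ⟨‖c‖₊ * K, LipschitzWith.of_dist_le_mul fun x y => ?_⟩
  have := hK.dist_le_mul x y
  simp only [Pi.smul_apply, smul_eq_mul, Real.dist_eq] at *
  rw [← mul_sub, abs_mul]
  push_cast
  rw [Real.norm_eq_abs, mul_assoc]
  gcongr

lemma IsLipBdd.mul {f g : X → ℝ} (hf : IsLipBdd f) (hg : IsLipBdd g) :
    IsLipBdd (fun x => f x * g x) := by
  obtain ⟨⟨K, hK⟩, C, hC⟩ := hf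
  obtain ⟨⟨L, hL⟩, D, hD⟩ := hg
  refine ⟨⟨C.toNNReal * L + D.toNNReal * K, LipschitzWith.of_dist_le_mul fun x y => ?_⟩,
    C * D, fun x => ?_⟩
  · have h1 := hK.dist_le_mul x y
    have h2 := hL.dist_le_mul x y
    have hC0 : 0 ≤ C := (abs_nonneg _).trans (hC x)
    have hD0 : 0 ≤ D := (abs_nonneg _).trans (hD x)
    push_cast
    rw [Real.coe_toNNReal _ hC0, Real.coe_toNNReal _ hD0]
    rw [Real.dist_eq] at *
    have : f x * g x - f y * g y = f x * (g x - g y) + g y * (f x - f y) := by ring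
    rw [this]
    refine (abs_add_le _ _).trans ?_
    rw [abs_mul, abs_mul, add_mul, mul_assoc, mul_assoc]
    gcongr
    · exact hC x
    · exact hD y
  · rw [abs_mul]
    have hC0 : 0 ≤ C := (abs_nonneg _).trans (hC x)
    gcongr
    · exact hC x
    · exact hD x

lemma IsLipBdd.add {f g : X → ℝ} (hf : IsLipBdd f) (hg : IsLipBdd g) : IsLipBdd (f + g) := by
  obtain ⟨h1, C, hC⟩ := hf
  obtain ⟨h2, D, hD⟩ := hg
  exact ⟨h1.add h2, C + D, fun x => (abs_add_le _ _).trans (add_le_add (hC x) (hD x))⟩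

lemma IsLipBdd.smul {f : X → ℝ} (c : ℝ) (hf : IsLipBdd f) : IsLipBdd (c • f) := by
  obtain ⟨h1, C, hC⟩ := hf
  refine ⟨h1.smul c, |c| * C, fun x => ?_⟩
  simp only [Pi.smul_apply, smul_eq_mul, abs_mul]
  gcongr
  exact hC x

lemma IsLip.continuous {f : X → ℝ} (hf : IsLip f) : Continuous f := hf.choose_spec.continuous

/-- the Lipschitz cutoff functions -/
lemma exists_cutoff (F : Set X) (hF : IsClosed F) : ∃ g : ℕ → X → ℝ, (∀ n, IsLipBdd (g n)) ∧
    (∀ n x, 0 ≤ g n x) ∧ (∀ n x, g n x ≤ 1) ∧ (∀ n, ∀ x ∈ F, g n x = 1) ∧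
    ∀ x, Tendsto (fun n => g n x) atTop (nhds (F.indicator (fun _ => 1) x)) := by
  have hpos : ∀ n : ℕ, (0:ℝ) < 1 / ((n:ℝ) + 1) := fun n => by positivity
  refine ⟨fun n x => (thickenedIndicator (hpos n) F x : ℝ), fun n => ⟨⟨(1 / ((n:ℝ) + 1)).toNNReal⁻¹, ?_⟩, 1, fun x => ?_⟩,
    fun n x => NNReal.coe_nonneg _, fun n x => ?_, fun n x hx => ?_, fun x => ?_⟩
  · have := lipschitzWith_thickenedIndicator (hpos n) F
    intro x y
    exact this x y
  · rw [abs_of_nonneg (NNReal.coe_nonneg _)]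
    exact_mod_cast thickenedIndicator_le_one (hpos n) F x
  · exact_mod_cast thickenedIndicator_le_one (hpos n) F x
  · show ((thickenedIndicator (hpos n) F x : NNReal) : ℝ) = 1
    rw [thickenedIndicator_one (hpos n) F hx]; rfl
  · have := thickenedIndicator_tendsto_indicator_closure hpos
      (tendsto_one_div_add_atTop_nhds_zero_nat) F
    rw [tendsto_pi_nhds] at this
    have h2 := (NNReal.continuous_coe.tendsto _).comp (this x)
    rw [hF.closure_eq] at h2
    have h3 : ((F.indicator (fun _ => (1 : NNReal)) x : NNReal) : ℝ) =
        F.indicator (fun _ => (1 : ℝ)) x := by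
      by_cases hx : x ∈ F <;> simp [hx]
    rw [h3] at h2
    exact h2

variable [MeasurableSpace X] [BorelSpace X]

lemma IsLipBdd.integrable {f : X → ℝ} (hf : IsLipBdd f) (μ : Measure X) [IsFiniteMeasure μ] :
    Integrable (fun x => |f x|) μ := by
  obtain ⟨h1, C, hC⟩ := hf
  refine Integrable.of_bound (C := C) (h1.continuous.abs.measurable.aestronglyMeasurable) ?_
  exact Eventually.of_forall fun x => by simpa using hC x

/-- limit of integrals against cutoffs -/
lemma tendsto_cutoff {f : X → ℝ} (hf : IsLipBdd f) (μ : Measure X) [IsFiniteMeasure μ]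
    {F : Set X} (hF : MeasurableSet F) {g : ℕ → X → ℝ} (hg : ∀ n, IsLipBdd (g n))
    (h0 : ∀ n x, 0 ≤ g n x) (h1 : ∀ n x, g n x ≤ 1)
    (hl : ∀ x, Tendsto (fun n => g n x) atTop (nhds (F.indicator (fun _ => 1) x))) :
    Tendsto (fun n => ∫ x, |g n x * f x| ∂μ) atTop (nhds (∫ x in F, |f x| ∂μ)) := by
  rw [← integral_indicator hF]
  refine tendsto_integral_of_dominated_convergence (fun x => |f x|) (fun n => ?_)
    (hf.integrable μ) (fun n => Eventually.of_forall fun x => ?_)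
    (Eventually.of_forall fun x => ?_)
  · exact (((hg n).mul hf).1.continuous.abs.measurable.aestronglyMeasurable)
  · simp only [Real.norm_eq_abs, abs_abs, abs_mul, abs_of_nonneg (h0 n x)]
    exact mul_le_of_le_one_left (abs_nonneg _) (h1 n x)
  · have := ((hl x).mul_const (f x)).abs
    convert this using 2
    by_cases hx : x ∈ F <;> simp [hx]

variable {k : ℕ}

/-- gluing along a closed set -/
lemma glue_closed {T : Func X k} (hM : IsMultilinear T) {μ ν : Measure X} [IsFiniteMeasure μ]
    [IsFiniteMeasure ν] (hμ : MassBound T μ) (hν : MassBound T ν) {F : Set X} (hF : IsClosed F)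
    {f : X → ℝ} {π : Fin k → X → ℝ} (hD : InDomain f π) :
    |T f π| ≤ (∏ i, (lipConst (π i) : ℝ)) * ((∫ x in F, |f x| ∂μ) + ∫ x in Fᶜ, |f x| ∂ν) := by
  obtain ⟨g, hg, h0, h1, -, hl⟩ := exists_cutoff F hF
  have hg' : ∀ n, IsLipBdd (fun x => 1 - g n x) := fun n => by
    have := (isLipBdd_const (X := X) 1).add ((hg n).smul (-1))
    convert this using 2
    simp [sub_eq_add_neg]
  have t1 := tendsto_cutoff hD.1 μ hF.measurableSet hg h0 h1 hl
  have t2 := tendsto_cutoff (F := Fᶜ) hD.1 ν hF.measurableSet.compl hg'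
    (fun n x => by linarith [h1 n x]) (fun n x => by linarith [h0 n x])
    (fun x => by
      have := (hl x).const_sub 1
      convert this using 2
      by_cases hx : x ∈ F <;> simp [hx])
  refine ge_of_tendsto' ((t1.add t2).const_mul _) fun n => ?_
  have hs : T f π = T (fun x => g n x * f x) π + T (fun x => (1 - g n x) * f x) π := by
    rw [← hM.1 _ _ _ ((hg n).mul hD.1) ((hg' n).mul hD.1) hD.2]
    congr 1
    ext x
    simp only [Pi.add_apply]; ring
  rw [hs, mul_add]
  refine (abs_add_le _ _).trans (add_le_add ?_ ?_)
  · exact hμ _ _ ⟨(hg n).mul hD.1, hD.2⟩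
  · exact hν _ _ ⟨(hg' n).mul hD.1, hD.2⟩

/-- gluing along a measurable set -/
lemma glue {T : Func X k} (hM : IsMultilinear T) {μ ν : Measure X} [IsFiniteMeasure μ]
    [IsFiniteMeasure ν] (hμ : MassBound T μ) (hν : MassBound T ν) {P : Set X}
    (hP : MeasurableSet P) : MassBound T (μ.restrict P + ν.restrict Pᶜ) := by
  intro f π hD
  have hprod : 0 ≤ ∏ i, (lipConst (π i) : ℝ) := Finset.prod_nonneg fun i _ => NNReal.coe_nonneg _
  rw [integral_add_measure (hD.1.integrable _) (hD.1.integrable _)]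
  obtain ⟨C, hC⟩ := hD.1.2
  have key : ∀ ε : ℝ, 0 < ε → |T f π| ≤ (∏ i, (lipConst (π i) : ℝ)) *
      ((∫ x in P, |f x| ∂μ) + (∫ x in Pᶜ, |f x| ∂ν) + |C| * ε) := by
    intro ε hε
    obtain ⟨F, hFP, hFc, hlt⟩ := hP.exists_isClosed_sdiff_lt (μ := ν) (measure_ne_top _ _)
      (ε := ENNReal.ofReal ε) (by simpa using hε)
    refine (glue_closed hM hμ hν hFc hD).trans ?_
    refine mul_le_mul_of_nonneg_left ?_ hprod
    have e1 : ∫ x in F, |f x| ∂μ ≤ ∫ x in P, |f x| ∂μ :=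
      setIntegral_mono_set (hD.1.integrable _) (Eventually.of_forall fun x => abs_nonneg _)
        (hFP.eventuallyLE)
    have e2 : ∫ x in Fᶜ, |f x| ∂ν = (∫ x in Pᶜ, |f x| ∂ν) + ∫ x in P \ F, |f x| ∂ν := by
      rw [← setIntegral_union]
      · congr 2
        ext x
        have := @hFP x
        simp only [mem_compl_iff, mem_union, Set.mem_sdiff]
        tauto
      · exact disjoint_left.2 fun x hx hx' => hx hx'.1
      · exact hP.diff hFc.measurableSet
      · exact hD.1.integrable _
      · exact hD.1.integrable _
    have e3 : ∫ x in P \ F, |f x| ∂ν ≤ |C| * ε := by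
      have := norm_setIntegral_le_of_norm_le_const (μ := ν) (s := P \ F) (f := fun x => |f x|)
        (C := |C|) (measure_lt_top _ _) (fun x _ => by simpa using (hC x).trans (le_abs_self C))
      refine (le_abs_self _).trans (this.trans ?_)
      gcongr
      exact ENNReal.toReal_le_of_le_ofReal hε.le hlt.le
    linarith
  have hlim : Tendsto (fun ε : ℝ => (∏ i, (lipConst (π i) : ℝ)) *
      ((∫ x in P, |f x| ∂μ) + (∫ x in Pᶜ, |f x| ∂ν) + |C| * ε)) (𝓝[>] 0)
      (𝓝 ((∏ i, (lipConst (π i) : ℝ)) *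
      ((∫ x in P, |f x| ∂μ) + (∫ x in Pᶜ, |f x| ∂ν) + |C| * 0))) := by
    apply Tendsto.mono_left _ nhdsWithin_le_nhds
    apply Continuous.tendsto
    fun_prop
  rw [mul_zero, add_zero] at hlim
  exact ge_of_tendsto hlim (by filter_upwards [self_mem_nhdsWithin] with ε hε using key ε hε)

lemma exists_small {T : Func X k} (hM : IsMultilinear T) {μ₀ : Measure X} [IsFiniteMeasure μ₀]
    (hμ₀ : MassBound T μ₀) {B : Set X} (hB : MeasurableSet B) (h0 : massMeasure T B = 0)
    {ε : ENNReal} (hε : ε ≠ 0) :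
    ∃ ν : Measure X, IsFiniteMeasure ν ∧ MassBound T ν ∧ ν B < ε := by
  set m := {μ : Measure X | IsFiniteMeasure μ ∧ MassBound T μ} with hm
  have hmne : m.Nonempty := ⟨μ₀, inferInstance, hμ₀⟩
  have hε4 : ε / 2 ≠ 0 := by simp [hε]
  have hε8 : ε / 2 / 2 ≠ 0 := by simp [hε]
  have h1 : massMeasure T B < ε / 2 / 2 := by rw [h0]; exact pos_iff_ne_zero.2 hε8
  rw [massMeasure, ← hm, Measure.sInf_apply hB, OuterMeasure.sInf_apply (hmne.image _)] at h1
  simp only [iInf_lt_iff, iInf_image] at h1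
  obtain ⟨t, hBt, hsum⟩ := h1
  obtain ⟨e, he, hes⟩ := ENNReal.exists_pos_sum_of_countable' hε8 ℕ
  have hch : ∀ n, ∃ μ : Measure X, μ ∈ m ∧ μ (t n) ≤ (⨅ μ ∈ m, μ (t n)) + e n := by
    intro n
    have hfin : (⨅ μ ∈ m, μ (t n)) ≠ ⊤ :=
      ne_top_of_le_ne_top (measure_ne_top μ₀ (t n)) (iInf₂_le μ₀ ⟨inferInstance, hμ₀⟩)
    have : (⨅ μ ∈ m, μ (t n)) < (⨅ μ ∈ m, μ (t n)) + e n :=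
      ENNReal.lt_add_right hfin (he n).ne'
    simp only [iInf_lt_iff] at this
    obtain ⟨μ, hμ, hlt⟩ := this
    exact ⟨μ, hμ, hlt.le⟩
  choose μ hμm hμt using hch
  have : ∀ n, IsFiniteMeasure (μ n) := fun n => (hμm n).1
  let s : ℕ → Set X := fun n => toMeasurable (μ n) (t n)
  have hs : ∀ n, MeasurableSet (s n) := fun n => measurableSet_toMeasurable _ _
  have hBs : B ⊆ ⋃ n, s n := hBt.trans (iUnion_mono fun n => subset_toMeasurable _ _)
  have hsum2 : ∑' n, μ n (s n) < ε / 2 := by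
    calc ∑' n, μ n (s n) = ∑' n, μ n (t n) := by simp [s, measure_toMeasurable]
      _ ≤ ∑' n, ((⨅ μ ∈ m, μ (t n)) + e n) := ENNReal.tsum_le_tsum hμt
      _ = ∑' n, (⨅ μ ∈ m, μ (t n)) + ∑' n, e n := ENNReal.tsum_add
      _ < ε / 2 / 2 + ε / 2 / 2 := ENNReal.add_lt_add hsum hes
      _ = ε / 2 := ENNReal.add_halves _
  have hind : ∀ N : ℕ, ∃ ν : Measure X, IsFiniteMeasure ν ∧ MassBound T ν ∧
      ∀ C, MeasurableSet C → ν C ≤ ∑ n ∈ Finset.range N, μ n (s n) +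
        μ₀ (C \ ⋃ n ∈ Finset.range N, s n) := by
    intro N
    induction N with
    | zero => exact ⟨μ₀, inferInstance, hμ₀, fun C _ => by simp⟩
    | succ N ih =>
      obtain ⟨ν, hν, hνb, hνC⟩ := ih
      refine ⟨(μ N).restrict (s N) + ν.restrict (s N)ᶜ, inferInstance,
        glue hM (hμm N).2 hνb (hs N), fun C hC => ?_⟩
      rw [Measure.add_apply, Measure.restrict_apply hC, Measure.restrict_apply hC,
        Finset.sum_range_succ, add_comm (∑ n ∈ Finset.range N, _), add_assoc]
      refine add_le_add (measure_mono inter_subset_right) ((hνC _ (hC.inter (hs N).compl)).trans ?_)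
      refine add_le_add le_rfl (measure_mono ?_)
      intro x
      simp only [Set.mem_sdiff, mem_inter_iff, mem_compl_iff, mem_iUnion, Finset.mem_range,
        not_exists]
      rintro ⟨⟨hx, hxN⟩, hx2⟩
      refine ⟨hx, fun n hn => ?_⟩
      rcases (Nat.lt_succ_iff.1 hn).eq_or_lt with h | h
      · subst h; exact hxN
      · exact hx2 n h
  have hlim : Tendsto (fun N : ℕ => μ₀ (B \ ⋃ n ∈ Finset.range N, s n)) atTop (𝓝 0) := by
    have := tendsto_measure_iInter_atTop (μ := μ₀)
      (s := fun N : ℕ => B \ ⋃ n ∈ Finset.range N, s n)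
      (fun N => (hB.diff (Finset.measurableSet_biUnion _ fun n _ => hs n)).nullMeasurableSet)
      (fun M N hMN => by
        apply sdiff_subset_sdiff_right
        apply biUnion_subset_biUnion_left
        intro n hn
        simp at hn ⊢
        omega) ⟨0, measure_ne_top _ _⟩
    have he : (⋂ N : ℕ, B \ ⋃ n ∈ Finset.range N, s n) = ∅ := ?_
    · rw [he, measure_empty] at this
      exact this
    rw [eq_empty_iff_forall_notMem]
    intro x hx
    rw [mem_iInter] at hx
    obtain ⟨n, hn⟩ := mem_iUnion.1 (hBs (hx 0).1)
    exact (hx (n+1)).2 (mem_biUnion (by simp) hn)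
  obtain ⟨N, hN⟩ := (hlim.eventually (gt_mem_nhds (pos_iff_ne_zero.2 hε4))).exists
  obtain ⟨ν, hν, hνb, hνC⟩ := hind N
  refine ⟨ν, hν, hνb, (hνC B hB).trans_lt ?_⟩
  calc _ < ε / 2 + ε / 2 := ENNReal.add_lt_add ((ENNReal.sum_le_tsum _).trans_lt hsum2) hN
    _ = ε := ENNReal.add_halves _

lemma massBound_restrict {T : Func X k} (hM : IsMultilinear T) {μ₀ : Measure X}
    [IsFiniteMeasure μ₀] (hμ₀ : MassBound T μ₀) {B : Set X} (hB : MeasurableSet B)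
    (h0 : massMeasure T B = 0) : MassBound T (μ₀.restrict Bᶜ) := by
  intro f π hD
  have hprod : 0 ≤ ∏ i, (lipConst (π i) : ℝ) := Finset.prod_nonneg fun i _ => NNReal.coe_nonneg _
  obtain ⟨C, hC⟩ := hD.1.2
  have key : ∀ ε : ℝ, 0 < ε → |T f π| ≤ (∏ i, (lipConst (π i) : ℝ)) *
      (|C| * ε + (∫ x in Bᶜ, |f x| ∂μ₀)) := by
    intro ε hε
    obtain ⟨ν, hν, hνb, hlt⟩ := exists_small hM hμ₀ hB h0 (ε := ENNReal.ofReal ε)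
      (by simpa using hε)
    refine (glue hM hνb hμ₀ hB f π hD).trans ?_
    rw [integral_add_measure (hD.1.integrable _) (hD.1.integrable _)]
    refine mul_le_mul_of_nonneg_left (add_le_add_left ?_ _) hprod
    have := norm_setIntegral_le_of_norm_le_const (μ := ν) (s := B) (f := fun x => |f x|)
        (C := |C|) (measure_lt_top _ _) (fun x _ => by simpa using (hC x).trans (le_abs_self C))
    refine (le_abs_self _).trans (this.trans ?_)
    gcongr
    exact ENNReal.toReal_le_of_le_ofReal hε.le hlt.le
  have hlim : Tendsto (fun ε : ℝ => (∏ i, (lipConst (π i) : ℝ)) *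
      (|C| * ε + (∫ x in Bᶜ, |f x| ∂μ₀))) (𝓝[>] 0)
      (𝓝 ((∏ i, (lipConst (π i) : ℝ)) * (|C| * 0 + (∫ x in Bᶜ, |f x| ∂μ₀)))) := by
    apply Tendsto.mono_left _ nhdsWithin_le_nhds
    apply Continuous.tendsto
    fun_prop
  rw [mul_zero, zero_add] at hlim
  exact ge_of_tendsto hlim (by filter_upwards [self_mem_nhdsWithin] with ε hε using key ε hε)

set_option linter.unusedSectionVars false in
lemma massMeasure_le {T : Func X k} {μ : Measure X} [IsFiniteMeasure μ] (h : MassBound T μ) :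
    massMeasure T ≤ μ := sInf_le ⟨inferInstance, h⟩

set_option linter.unusedSectionVars false in
lemma isClosed_msupport (μ : Measure X) : IsClosed (msupport μ) := by
  rw [← isOpen_compl_iff, Metric.isOpen_iff]
  intro x hx
  simp only [msupport, mem_compl_iff, mem_ofPred_eq, not_forall] at hx
  obtain ⟨r, hr, h0⟩ := hx
  refine ⟨r / 2, by positivity, fun y hy hys => h0 ((hys (r/2) (by positivity)).trans_le
    (measure_mono (Metric.ball_subset_ball' ?_)))⟩
  have := Metric.mem_ball.1 hy
  linarith

/-- a current has a finite dominating measure concentrated on the support -/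
lemma exists_good {T : Func X k} (hM : IsMultilinear T) (hfm : HasFiniteMass T) :
    ∃ μ : Measure X, IsFiniteMeasure μ ∧ MassBound T μ ∧ μ (msupport (massMeasure T))ᶜ = 0 := by
  obtain ⟨μ₀, hfin, htight, hb⟩ := hfm
  set S := msupport (massMeasure T) with hS
  have hSc : IsClosed S := isClosed_msupport _
  have hle : massMeasure T ≤ μ₀ := massMeasure_le hb
  have h0 : massMeasure T Sᶜ = 0 := by
    have hK : ∀ n : ℕ, ∃ K : Set X, IsCompact K ∧ μ₀ Kᶜ < ((n : ENNReal) + 1)⁻¹ := fun n =>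
      htight _ (by simp)
    choose K hKc hKm using hK
    obtain ⟨F, hFc, -, hFU, -⟩ := hSc.isOpen_compl.exists_iUnion_isClosed
    have hz : ∀ n m, massMeasure T (K n ∩ F m) = 0 := fun n m => by
      apply ((hKc n).inter_right (hFc m)).measure_zero_of_nhdsWithin
      intro x hx
      have hxS : x ∈ Sᶜ := hFU ▸ mem_iUnion_of_mem m hx.2
      simp only [hS, msupport, mem_compl_iff, mem_ofPred_eq, not_forall] at hxS
      obtain ⟨r, hr, h0⟩ := hxS
      exact ⟨_, mem_nhdsWithin_of_mem_nhds (Metric.ball_mem_nhds x hr), by simpa using h0⟩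
    have hrest : massMeasure T (⋂ n, (K n)ᶜ) = 0 := by
      apply le_antisymm _ (zero_le)
      refine (hle _).trans ?_
      refine ge_of_tendsto' (b := μ₀ (⋂ n, (K n)ᶜ)) (f := fun n : ℕ => ((n : ENNReal) + 1)⁻¹) (x := atTop) ?_
        fun n => (measure_mono (iInter_subset _ n)).trans (hKm n).le
      have := (ENNReal.tendsto_inv_nat_nhds_zero).comp (tendsto_add_atTop_nat 1)
      refine this.congr fun n => ?_
      simp
    refine measure_mono_null (t := (⋃ n, ⋃ m, K n ∩ F m) ∪ ⋂ n, (K n)ᶜ) ?_ ?_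
    · intro x hx
      by_cases h : ∃ n, x ∈ K n
      · obtain ⟨n, hn⟩ := h
        rw [← hFU] at hx
        obtain ⟨m, hm⟩ := mem_iUnion.1 hx
        exact Or.inl (mem_iUnion.2 ⟨n, mem_iUnion.2 ⟨m, hn, hm⟩⟩)
      · right
        push Not at h
        exact mem_iInter.2 h
    · exact measure_union_null (measure_iUnion_null fun n => measure_iUnion_null fun m => hz n m)
        hrest
  refine ⟨μ₀.restrict S, inferInstance, ?_, ?_⟩
  · have := massBound_restrict hM hb hSc.measurableSet.compl h0
    rwa [compl_compl] at this
  · rw [Measure.restrict_apply hSc.measurableSet.compl]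
    simp

end basics

section dep
set_option linter.unusedSectionVars false
variable {X : Type*} [PseudoMetricSpace X] [MeasurableSpace X] {k : ℕ}

lemma zero_of_f {T : Func X k} {μ : Measure X} {S : Set X} (hμ : MassBound T μ)
    (hS : μ Sᶜ = 0) {f : X → ℝ} {π : Fin k → X → ℝ} (hD : InDomain f π)
    (hf : ∀ x ∈ S, f x = 0) : T f π = 0 := by
  have h := hμ f π hD
  have h2 : ∫ x, |f x| ∂μ = 0 := by
    apply integral_eq_zero_of_ae
    have : ∀ᵐ x ∂μ, x ∈ S := by rw [ae_iff]; exact hS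
    filter_upwards [this] with x hx
    simp [hf x hx]
  rw [h2, mul_zero] at h
  exact abs_nonpos_iff.1 h

lemma f_congr {T : Func X k} {μ : Measure X} {S : Set X} (hM : IsMultilinear T)
    (hμ : MassBound T μ) (hS : μ Sᶜ = 0) {f g : X → ℝ} {π : Fin k → X → ℝ}
    (hD : InDomain f π) (hg : IsLipBdd g) (hfg : ∀ x ∈ S, f x = g x) : T f π = T g π := by
  have h1 : IsLipBdd (f + (-1 : ℝ) • g) := hD.1.add (hg.smul _)
  have h0 := zero_of_f hμ hS (f := f + (-1 : ℝ) • g) (π := π) ⟨h1, hD.2⟩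
    (fun x hx => by simp [hfg x hx])
  rw [hM.1 _ _ _ hD.1 (hg.smul _) hD.2, hM.2.1 _ _ _ hg hD.2] at h0
  linarith

lemma clamp_lip {K : NNReal} {p : X → ℝ} (hp : LipschitzWith K p) (e : ℝ) :
    LipschitzWith K (fun x => max (-e) (min (p x) e)) := (hp.min_const e).const_max (-e)

lemma abs_clamp_le (t : ℝ) {e : ℝ} (he : 0 ≤ e) : |max (-e) (min t e)| ≤ e := by
  rw [abs_le]
  exact ⟨le_max_left _ _, max_le (by linarith) (min_le_right _ _)⟩

lemma clamp_eq {t e : ℝ} (h : |t| ≤ e) : max (-e) (min t e) = t := by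
  rw [abs_le] at h
  rw [min_eq_left h.2, max_eq_right h.1]

lemma zero_of_mul {T : Func X k} {μ : Measure X} {S : Set X} (hM : IsMultilinear T)
    (hL : SatisfiesLocality T) (hC : SatisfiesContinuity T)
    (hμ : MassBound T μ) (hS : μ Sᶜ = 0) {f : X → ℝ} {π : Fin k → X → ℝ}
    (hD : InDomain f π) (i : Fin k) (h0 : ∀ x ∈ S, f x * π i x = 0) : T f π = 0 := by
  choose K hK using hD.2
  let e : ℕ → ℝ := fun n => 1 / ((n : ℝ) + 1)
  have he : ∀ n, 0 < e n := fun n => by simp only [e]; positivity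
  have hlim : Tendsto e atTop (𝓝 0) := tendsto_one_div_add_atTop_nhds_zero_nat
  let p : ℕ → X → ℝ := fun n x => π i x - max (-e n) (min (π i x) (e n))
  have hp : ∀ n, LipschitzWith (K i + K i) (p n) := fun n => (hK i).sub (clamp_lip (hK i) _)
  let πs : ℕ → Fin k → X → ℝ := fun n => Function.update π i (p n)
  have hπs : ∀ n j, LipschitzWith (∑ j, (K j + K j)) (πs n j) := by
    intro n j
    have hle : K j + K j ≤ ∑ j, (K j + K j) :=
      Finset.single_le_sum (f := fun j => K j + K j) (fun _ _ => zero_le) (Finset.mem_univ j)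
    by_cases hj : j = i
    · subst hj
      simp only [πs, Function.update_self]
      exact (hp n).weaken hle
    · simp only [πs, Function.update_of_ne hj]
      exact (hK j).weaken ((le_add_of_nonneg_left zero_le).trans hle)
  have ht := hC f πs π hD.1 ⟨_, hπs⟩ hD.2 (by
    intro j x
    by_cases hj : j = i
    · subst hj
      simp only [πs, Function.update_self, p]
      have : Tendsto (fun n => max (-e n) (min (π j x) (e n))) atTop (𝓝 0) :=
        squeeze_zero_norm (fun n => abs_clamp_le _ (he n).le) hlim
      simpa using this.const_sub (π j x)
    · simp only [πs, Function.update_of_ne hj]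
      exact tendsto_const_nhds)
  have hz : ∀ n, T f (πs n) = 0 := by
    intro n
    have hmin : IsLipBdd (fun x => min |π i x| (e n)) := by
      refine ⟨⟨K i, ?_⟩, e n, fun x => ?_⟩
      · have h1 : LipschitzWith (1 * K i) (fun x => |π i x|) :=
          (LipschitzWith.of_dist_le_mul (fun a b => by
            simp only [Real.dist_eq, NNReal.coe_one, one_mul]
            exact abs_abs_sub_abs_le_abs_sub a b) : LipschitzWith 1 (fun t : ℝ => |t|)).comp (hK i)
        rw [one_mul] at h1
        exact h1.min_const _
      · rw [abs_of_nonneg (le_min (abs_nonneg _) (he n).le)]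
        exact min_le_right _ _
    have hχ := (isLipBdd_const (X := X) 1).add (hmin.smul (-(e n)⁻¹))
    have hfχ := hD.1.mul hχ
    have hdom : ∀ j, IsLip (πs n j) := fun j => ⟨_, hπs n j⟩
    rw [f_congr hM hμ hS ⟨hD.1, hdom⟩ hfχ]
    · refine hL _ _ ⟨hfχ, hdom⟩ ⟨i, ?_⟩
      have : ∀ x ∈ {y | f y * ((fun _ => (1:ℝ) : X → ℝ) + (-(e n)⁻¹) • (fun x => min |π i x| (e n) : X → ℝ)) y ≠ 0},
          πs n i x = 0 := by
        intro x hx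
        simp only [πs, Function.update_self, p]
        rw [clamp_eq, sub_self]
        by_contra hcon
        push Not at hcon
        apply hx
        have := (he n).ne'
        simp only [Pi.add_apply, Pi.smul_apply, smul_eq_mul, min_eq_right hcon.le]
        field_simp
        simp
      intro x hx x' hx'
      rw [this x hx, this x' hx']
    · intro x hx
      rcases mul_eq_zero.1 (h0 x hx) with h | h
      · simp [h]
      · simp [h, (he n).le]
  simp only [hz] at ht
  exact tendsto_nhds_unique ht tendsto_const_nhds

lemma isLip_update {π : Fin k → X → ℝ} (h : ∀ i, IsLip (π i)) (i : Fin k) {g : X → ℝ}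
    (hg : IsLip g) : ∀ j, IsLip (Function.update π i g j) := by
  intro j
  by_cases hj : j = i
  · subst hj; simpa using hg
  · simpa [Function.update_of_ne hj] using h j

lemma pi_congr_one {T : Func X k} {μ : Measure X} {S : Set X} (hM : IsMultilinear T)
    (hL : SatisfiesLocality T) (hC : SatisfiesContinuity T)
    (hμ : MassBound T μ) (hS : μ Sᶜ = 0) {f : X → ℝ} {π : Fin k → X → ℝ}
    (hD : InDomain f π) (i : Fin k) {g g' : X → ℝ} (hg : IsLip g) (hg' : IsLip g')
    (h0 : ∀ x ∈ S, f x * g x = f x * g' x) :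
    T f (Function.update π i g) = T f (Function.update π i g') := by
  have h1 : IsLip (g + (-1 : ℝ) • g') := hg.add (hg'.smul _)
  have := zero_of_mul hM hL hC hμ hS (f := f) (π := Function.update π i (g + (-1 : ℝ) • g'))
    ⟨hD.1, isLip_update hD.2 i h1⟩ i (fun x hx => by
      have := h0 x hx
      simp only [Function.update_self, Pi.add_apply, Pi.smul_apply, smul_eq_mul]
      linarith)
  rw [hM.2.2.1 _ _ _ _ _ hD.1 hD.2 hg (hg'.smul _), hM.2.2.2 _ _ _ _ _ hD.1 hD.2 hg'] at this
  linarith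

lemma all_congr {T : Func X k} {μ : Measure X} {S : Set X} (hM : IsMultilinear T)
    (hL : SatisfiesLocality T) (hC : SatisfiesContinuity T)
    (hμ : MassBound T μ) (hS : μ Sᶜ = 0) {f f' : X → ℝ} {π π' : Fin k → X → ℝ}
    (hD : InDomain f π) (hD' : InDomain f' π') (hf : ∀ x ∈ S, f x = f' x)
    (hπ : ∀ i, ∀ x ∈ S, π i x = π' i x) : T f π = T f' π' := by
  rw [f_congr hM hμ hS hD hD'.1 hf]
  have key : ∀ s : Finset (Fin k), T f' π = T f' (fun i => if i ∈ s then π' i else π i) := by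
    intro s
    induction s using Finset.induction_on with
    | empty => simp
    | insert a s ha ih =>
      rw [ih]
      have hdom : ∀ i, IsLip ((fun i => if i ∈ s then π' i else π i) i) := by
        intro i
        by_cases hi : i ∈ s
        · simpa [hi] using hD'.2 i
        · simpa [hi] using hD.2 i
      have e1 : (fun i => if i ∈ s then π' i else π i) =
          Function.update (fun i => if i ∈ s then π' i else π i) a (π a) := by
        ext j
        by_cases hj : j = a
        · subst hj; simp [ha]
        · simp [Function.update_of_ne hj]
      have e2 : (fun i => if i ∈ insert a s then π' i else π i) =
          Function.update (fun i => if i ∈ s then π' i else π i) a (π' a) := by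
        ext j
        by_cases hj : j = a
        · subst hj; simp
        · simp [Function.update_of_ne hj, hj]
      rw [e2]
      conv_lhs => rw [e1]
      exact pi_congr_one hM hL hC hμ hS ⟨hD'.1, hdom⟩ a (hD.2 a) (hD'.2 a)
        (fun x hx => by rw [hπ a x hx])
  simpa using key Finset.univ

/-- uniformly Lipschitz sequences vanishing in the limit on a compact set can be modified off it so
that they converge to zero everywhere -/
lemma conv_ext {S : Set X} (hS : IsCompact S) {K : NNReal} {d : ℕ → X → ℝ}
    (hd : ∀ j, LipschitzWith K (d j))
    (hl : ∀ x ∈ S, Tendsto (fun j => d j x) atTop (𝓝 0)) :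
    ∃ D : ℕ → X → ℝ, (∀ j, LipschitzWith K (D j)) ∧ (∀ j, ∀ x ∈ S, D j x = d j x) ∧
      ∀ x, Tendsto (fun j => D j x) atTop (𝓝 0) := by
  let c : ℕ → ℝ := fun j => sSup ((fun x => |d j x|) '' S)
  have hbdd : ∀ j, BddAbove ((fun x => |d j x|) '' S) := fun j =>
    (hS.image (hd j).continuous.abs).bddAbove
  have hc0 : ∀ j, 0 ≤ c j := fun j => Real.sSup_nonneg (by rintro _ ⟨x, -, rfl⟩; positivity)
  have hunif : ∀ ε > 0, ∀ᶠ j in atTop, c j ≤ ε := by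
    intro ε hε
    have hr : 0 < ε / (2 * ((K:ℝ) + 1)) := by positivity
    obtain ⟨t, htS, htf, htc⟩ := hS.finite_cover_balls hr
    have : ∀ᶠ j in atTop, ∀ y ∈ t, |d j y| < ε / 2 := by
      rw [Filter.eventually_all_finite htf]
      intro y hy
      have := (hl y (htS hy)).abs
      rw [abs_zero] at this
      exact this.eventually (gt_mem_nhds (by positivity))
    filter_upwards [this] with j hj
    apply Real.sSup_le _ hε.le
    rintro _ ⟨x, hx, rfl⟩
    obtain ⟨y, hy, hxy⟩ := mem_iUnion₂.1 (htc hx)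
    have h1 := (hd j).dist_le_mul x y
    have h2 := hj y hy
    have h3 : (K:ℝ) * dist x y ≤ ε / 2 := by
      have : dist x y ≤ ε / (2 * ((K:ℝ) + 1)) := (Metric.mem_ball.1 hxy).le
      calc (K:ℝ) * dist x y ≤ ((K:ℝ) + 1) * (ε / (2 * ((K:ℝ) + 1))) := by
            gcongr; linarith
        _ = ε / 2 := by field_simp
    rw [Real.dist_eq] at h1
    have h4 := abs_sub_abs_le_abs_sub (d j x) (d j y)
    show |d j x| ≤ ε
    linarith
  have hct : Tendsto c atTop (𝓝 0) := by
    rw [Metric.tendsto_nhds]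
    intro ε hε
    filter_upwards [hunif (ε / 2) (by positivity)] with j hj
    rw [Real.dist_eq, sub_zero, abs_of_nonneg (hc0 j)]
    linarith
  refine ⟨fun j x => max (-c j) (min (d j x) (c j)), fun j => clamp_lip (hd j) _,
    fun j x hx => clamp_eq (le_csSup (hbdd j) ⟨x, hx, rfl⟩),
    fun x => squeeze_zero_norm (fun j => abs_clamp_le _ (hc0 j)) hct⟩

set_option linter.unusedSectionVars false in
lemma msupport_subset {ν μ : Measure X} (h : ν ≤ μ) {C : Set X} (hC : IsClosed C)
    (h0 : μ Cᶜ = 0) : msupport ν ⊆ C := by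
  intro x hx
  by_contra hxC
  obtain ⟨r, hr, hb⟩ := Metric.isOpen_iff.1 hC.isOpen_compl x hxC
  have := hx r hr
  exact this.ne' (le_antisymm (((h _).trans (measure_mono hb)).trans h0.le) zero_le)

end dep

section extension
variable {X : Type*} [MetricSpace X] {A : Set X}

lemma exists_ext (f : A → ℝ) (hf : IsLip f) : ∃ g : X → ℝ, LipschitzWith (lipConst f) g ∧
    (∀ a : A, g a = f a) ∧ (IsLipBdd f → IsLipBdd g) := by
  have hl := lipschitz_lipConst hf
  have h1 : LipschitzOnWith (lipConst f) (Function.extend Subtype.val f 0) A := by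
    intro x hx y hy
    have ex : Function.extend Subtype.val f 0 x = f ⟨x, hx⟩ :=
      Subtype.val_injective.extend_apply f 0 ⟨x, hx⟩
    have ey : Function.extend Subtype.val f 0 y = f ⟨y, hy⟩ :=
      Subtype.val_injective.extend_apply f 0 ⟨y, hy⟩
    rw [ex, ey]
    exact hl ⟨x, hx⟩ ⟨y, hy⟩
  obtain ⟨g, hg, hgA⟩ := h1.extend_real
  have hga : ∀ a : A, g a = f a := fun a => by
    rw [← hgA a.2]
    exact Subtype.val_injective.extend_apply f 0 a
  by_cases hb : IsLipBdd f
  · obtain ⟨-, C, hC⟩ := hb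
    refine ⟨fun x => max (-|C|) (min (g x) |C|), (hg.min_const _).const_max _, fun a => ?_,
      fun _ => ⟨⟨_, (hg.min_const _).const_max _⟩, |C|, fun x => abs_clamp_le _ (abs_nonneg _)⟩⟩
    show max (-|C|) (min (g a) |C|) = f a
    rw [hga]
    exact clamp_eq ((hC a).trans (le_abs_self C))
  · exact ⟨g, hg, hga, fun h => absurd h hb⟩

open Classical in
/-- a Lipschitz extension of `f` -/
def extF (f : A → ℝ) : X → ℝ := if h : IsLip f then (exists_ext f h).choose else 0

lemma extF_lip {f : A → ℝ} (h : IsLip f) : LipschitzWith (lipConst f) (extF f) := by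
  rw [extF, dif_pos h]; exact (exists_ext f h).choose_spec.1

lemma extF_isLip {f : A → ℝ} (h : IsLip f) : IsLip (extF f) := ⟨_, extF_lip h⟩

lemma extF_apply {f : A → ℝ} (h : IsLip f) (a : A) : extF f a = f a := by
  rw [extF, dif_pos h]; exact (exists_ext f h).choose_spec.2.1 a

lemma extF_mem {f : A → ℝ} (h : IsLip f) {x : X} (hx : x ∈ A) : extF f x = f ⟨x, hx⟩ :=
  extF_apply h ⟨x, hx⟩

lemma extF_bdd {f : A → ℝ} (h : IsLipBdd f) : IsLipBdd (extF f) := by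
  rw [extF, dif_pos h.1]; exact (exists_ext f h.1).choose_spec.2.2 h

lemma extF_dom {k : ℕ} {f : A → ℝ} {π : Fin k → A → ℝ} (h : InDomain f π) :
    InDomain (extF f) (fun i => extF (π i)) := ⟨extF_bdd h.1, fun i => extF_isLip (h.2 i)⟩

lemma extF_update {k : ℕ} (π : Fin k → A → ℝ) (i : Fin k) (g : A → ℝ) :
    (fun j => extF (Function.update π i g j)) =
      Function.update (fun j => extF (π j)) i (extF g) := by
  ext j
  by_cases hj : j = i
  · subst hj; simp
  · simp [Function.update_of_ne hj]

variable [MeasurableSpace X] [BorelSpace X]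

lemma exists_pullback {S : Set X} (hS : IsCompact S) (hSA : S ⊆ A) (ν : Measure X)
    [IsFiniteMeasure ν] (h0 : ν Sᶜ = 0) : ∃ ν' : Measure A, IsFiniteMeasure ν' ∧
      IsTightMeasure ν' ∧ ν'.map Subtype.val = ν ∧ ν' (Subtype.val ⁻¹' S)ᶜ = 0 := by
  have hSm : MeasurableSet S := hS.isClosed.measurableSet
  have hi : Measurable (inclusion hSA) := (continuous_inclusion hSA).measurable
  let ν' : Measure A := (ν.comap (Subtype.val : S → X)).map (inclusion hSA)
  have hmap : ν'.map Subtype.val = ν := by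
    rw [Measure.map_map measurable_subtype_coe hi]
    have : (Subtype.val ∘ inclusion hSA) = (Subtype.val : S → X) := rfl
    rw [this, map_comap_subtype_coe hSm]
    apply Measure.restrict_eq_self_of_ae_mem
    rw [ae_iff]; exact h0
  have hz : ν' (Subtype.val ⁻¹' S)ᶜ = 0 := by
    rw [← preimage_compl, ← Measure.map_apply measurable_subtype_coe hSm.compl, hmap, h0]
  have hfin : IsFiniteMeasure ν' := by
    constructor
    have : ν' univ = ν univ := by
      conv_rhs => rw [← hmap]
      rw [Measure.map_apply measurable_subtype_coe MeasurableSet.univ, preimage_univ]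
    rw [this]
    exact measure_lt_top _ _
  refine ⟨ν', hfin, fun ε hε => ⟨Subtype.val ⁻¹' S, ?_, hz ▸ hε⟩, hmap, hz⟩
  exact Topology.IsInducing.subtypeVal.isCompact_preimage' hS (by simpa using hSA)

lemma transfer_bound {k : ℕ} {U : Func X k} {U' : Func A k} {ν : Measure X} {ν' : Measure A}
    (hb : MassBound U ν) (hmap : ν'.map Subtype.val = ν)
    (hU : ∀ f π, InDomain f π → U' f π = U (extF f) (fun i => extF (π i))) :
    MassBound U' ν' := by
  intro f π hD
  rw [hU f π hD]
  refine (hb _ _ (extF_dom hD)).trans ?_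
  rw [← hmap, integral_map measurable_subtype_coe.aemeasurable
    (extF_bdd hD.1).1.continuous.abs.measurable.aestronglyMeasurable]
  simp only [extF_apply hD.1.1]
  refine mul_le_mul_of_nonneg_right ?_ (integral_nonneg fun _ => abs_nonneg _)
  exact Finset.prod_le_prod (fun i _ => NNReal.coe_nonneg _) fun i _ => by
    exact_mod_cast lipConst_le (extF_lip (hD.2 i))

end extension

section main
variable {X : Type*} [MetricSpace X] [MeasurableSpace X] [BorelSpace X] {k : ℕ}

set_option linter.unusedSectionVars false in
lemma IsLip.comp_val {A : Set X} {f : X → ℝ} (h : IsLip f) : IsLip (f ∘ (Subtype.val : A → X)) := by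
  obtain ⟨K, hK⟩ := h
  exact ⟨K, fun x y => hK x y⟩

set_option linter.unusedSectionVars false in
lemma IsLipBdd.comp_val {A : Set X} {f : X → ℝ} (h : IsLipBdd f) :
    IsLipBdd (f ∘ (Subtype.val : A → X)) := by
  obtain ⟨hl, C, hC⟩ := h
  exact ⟨hl.comp_val, C, fun x => hC x⟩

lemma forward (A : Set X) (T : Func X k) (T' : Func A k) (hT' : MemNkc T')
    (he : DkEq (pushF (Subtype.val : A → X) T') T) : msupport (massMeasure T) ⊆ A := by
  obtain ⟨⟨hM, hfm, -, -⟩, -, hc⟩ := hT'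
  obtain ⟨μ', hfin, hb, h0⟩ := exists_good hM hfm
  set S' := msupport (massMeasure T')
  have hmb : MassBound T (μ'.map Subtype.val) := by
    intro f π hD
    rw [← he f π hD, integral_map measurable_subtype_coe.aemeasurable
      hD.1.1.continuous.abs.measurable.aestronglyMeasurable]
    refine (hb _ _ ⟨hD.1.comp_val, fun i => (hD.2 i).comp_val⟩).trans ?_
    refine mul_le_mul_of_nonneg_right ?_ (integral_nonneg fun _ => abs_nonneg _)
    refine Finset.prod_le_prod (fun i _ => NNReal.coe_nonneg _) fun i _ => ?_
    have hle : LipschitzWith (lipConst (π i)) (π i ∘ (Subtype.val : A → X)) :=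
      fun x y => lipschitz_lipConst (hD.2 i) x y
    exact_mod_cast lipConst_le hle
  have hC : IsCompact ((Subtype.val : A → X) '' S') := hc.image continuous_subtype_val
  have hsub := msupport_subset (massMeasure_le hmb) hC.isClosed (by
    rw [Measure.map_apply measurable_subtype_coe hC.isClosed.measurableSet.compl, preimage_compl,
      preimage_image_eq _ Subtype.val_injective]
    exact h0)
  rintro x hx
  obtain ⟨a, -, rfl⟩ := hsub hx
  exact a.2

lemma backward (A : Set X) (T : Func X k) (hT : MemNkc T) (hSA : msupport (massMeasure T) ⊆ A) :
    ∃ T' : Func A k, MemNkc T' ∧ DkEq (pushF (Subtype.val : A → X) T') T := by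
  obtain ⟨⟨hM, hfm, hL, hC⟩, hN, hS⟩ := hT
  obtain ⟨μ, hfin, hb, h0⟩ := exists_good hM hfm
  set S := msupport (massMeasure T)
  obtain ⟨μ', hfin', htight', hmap', h0'⟩ := exists_pullback hS hSA μ h0
  have hcong : ∀ (f f' : X → ℝ) (π π' : Fin k → X → ℝ), InDomain f π → InDomain f' π' →
      (∀ x ∈ S, f x = f' x) → (∀ i, ∀ x ∈ S, π i x = π' i x) → T f π = T f' π' :=
    fun f f' π π' hD hD' h1 h2 => all_congr hM hL hC hb h0 hD hD' h1 h2
  let T' : Func A k := fun f π => T (extF f) (fun i => extF (π i))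
  have hb' : MassBound T' μ' := transfer_bound hb hmap' (fun f π _ => rfl)
  refine ⟨T', ⟨⟨⟨?_, ?_, ?_, ?_⟩, ⟨μ', hfin', htight', hb'⟩, ?_, ?_⟩, ?_, ?_⟩, ?_⟩
  · -- additivity in `f`
    intro f g π hf hg hπ
    have hπ' : ∀ i, IsLip (extF (π i)) := fun i => extF_isLip (hπ i)
    have := hM.1 _ _ _ (extF_bdd hf) (extF_bdd hg) hπ'
    rw [← this]
    refine hcong _ _ _ _ ⟨extF_bdd (hf.add hg), hπ'⟩ ⟨(extF_bdd hf).add (extF_bdd hg), hπ'⟩ ?_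
      (fun _ _ _ => rfl)
    intro x hx
    simp [extF_mem (hf.add hg).1 (hSA hx), extF_mem hf.1 (hSA hx), extF_mem hg.1 (hSA hx)]
  · intro c f π hf hπ
    have hπ' : ∀ i, IsLip (extF (π i)) := fun i => extF_isLip (hπ i)
    have := hM.2.1 c _ _ (extF_bdd hf) hπ'
    rw [← this]
    refine hcong _ _ _ _ ⟨extF_bdd (hf.smul c), hπ'⟩ ⟨(extF_bdd hf).smul c, hπ'⟩ ?_
      (fun _ _ _ => rfl)
    intro x hx
    simp [extF_mem (hf.smul c).1 (hSA hx), extF_mem hf.1 (hSA hx)]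
  · intro f π i g g' hf hπ hg hg'
    have hπ' : ∀ i, IsLip (extF (π i)) := fun i => extF_isLip (hπ i)
    simp only [T', extF_update]
    rw [← hM.2.2.1 _ _ _ _ _ (extF_bdd hf) hπ' (extF_isLip hg) (extF_isLip hg')]
    refine pi_congr_one hM hL hC hb h0 ⟨extF_bdd hf, hπ'⟩ i (extF_isLip (hg.add hg'))
      ((extF_isLip hg).add (extF_isLip hg')) ?_
    intro x hx
    simp [extF_mem (hg.add hg') (hSA hx), extF_mem hg (hSA hx), extF_mem hg' (hSA hx)]
  · intro f π i c g hf hπ hg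
    have hπ' : ∀ i, IsLip (extF (π i)) := fun i => extF_isLip (hπ i)
    simp only [T', extF_update]
    rw [← hM.2.2.2 _ _ _ _ _ (extF_bdd hf) hπ' (extF_isLip hg)]
    refine pi_congr_one hM hL hC hb h0 ⟨extF_bdd hf, hπ'⟩ i (extF_isLip (hg.smul c))
      ((extF_isLip hg).smul c) ?_
    intro x hx
    simp [extF_mem (hg.smul c) (hSA hx), extF_mem hg (hSA hx)]
  · -- locality
    rintro f π hD ⟨i, hi⟩
    have hD' := extF_dom hD
    obtain ⟨c, hc⟩ : ∃ c : ℝ, ∀ a : A, f a ≠ 0 → π i a = c := by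
      by_cases h : ∃ a, f a ≠ 0
      · obtain ⟨a, ha⟩ := h
        exact ⟨π i a, fun b hb => hi b hb a ha⟩
      · push Not at h
        exact ⟨0, fun a ha => absurd (h a) ha⟩
    have e := pi_congr_one hM hL hC hb h0 hD' i (extF_isLip (hD.2 i)) (isLip_const c) (by
      intro x hx
      by_cases hz : f ⟨x, hSA hx⟩ = 0
      · simp [extF_mem hD.1.1 (hSA hx), hz]
      · simp [extF_mem (hD.2 i) (hSA hx), hc _ hz])
    have e2 : Function.update (fun i => extF (π i)) i (extF (π i)) = fun i => extF (π i) :=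
      Function.update_eq_self i _
    rw [e2] at e
    show T _ _ = 0
    rw [e]
    exact hL _ _ ⟨hD'.1, isLip_update hD'.2 i (isLip_const c)⟩ ⟨i, fun x _ x' _ => by simp⟩
  · -- continuity
    rintro f πs π hf ⟨K, hK⟩ hπ hlim
    have hπs : ∀ j i, IsLip (πs j i) := fun j i => ⟨K, hK j i⟩
    have hd : ∀ i, ∃ D : ℕ → X → ℝ, (∀ j, LipschitzWith (K + lipConst (π i)) (D j)) ∧
        (∀ j, ∀ x ∈ S, D j x = extF (πs j i) x - extF (π i) x) ∧
        ∀ x, Tendsto (fun j => D j x) atTop (𝓝 0) := by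
      intro i
      refine conv_ext hS (d := fun j x => extF (πs j i) x - extF (π i) x) (fun j => ?_) ?_
      · exact ((extF_lip (hπs j i)).weaken (lipConst_le (hK j i))).sub (extF_lip (hπ i))
      · intro x hx
        simp only [extF_mem (hπ i) (hSA hx), extF_mem (hπs _ i) (hSA hx)]
        simpa using (hlim i ⟨x, hSA hx⟩).sub_const (π i ⟨x, hSA hx⟩)
    choose D hDl hDS hD0 using hd
    let P : ℕ → Fin k → X → ℝ := fun j i x => extF (π i) x + D i j x
    have hPl : ∀ j i, LipschitzWith (∑ i, (lipConst (π i) + (K + lipConst (π i)))) (P j i) := by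
      intro j i
      refine LipschitzWith.weaken ((extF_lip (hπ i)).add (hDl i j)) ?_
      exact Finset.single_le_sum (f := fun i => lipConst (π i) + (K + lipConst (π i)))
        (fun _ _ => zero_le) (Finset.mem_univ i)
    have ht := hC (extF f) P (fun i => extF (π i)) (extF_bdd hf) ⟨_, hPl⟩
      (fun i => extF_isLip (hπ i)) (fun i x => by
        simpa [P] using (hD0 i x).const_add (extF (π i) x))
    refine ht.congr fun j => ?_
    refine hcong _ _ _ _ ⟨extF_bdd hf, fun i => ⟨_, hPl j i⟩⟩
      ⟨extF_bdd hf, fun i => extF_isLip (hπs j i)⟩ (fun _ _ => rfl) ?_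
    intro i x hx
    simp [P, hDS i j x hx]
  · -- normality
    cases k with
    | zero => trivial
    | succ k =>
      obtain ⟨ν, hνf, -, hνb⟩ := hN
      have hSc : IsClosed S := hS.isClosed
      have hcons : ∀ {f : X → ℝ} {π : Fin k → X → ℝ}, InDomain f π →
          ∀ i, IsLip ((Fin.cons f π : Fin (k+1) → X → ℝ) i) := by
        intro f π hD i
        refine Fin.cases ?_ (fun j => ?_) i
        · exact hD.1.1
        · exact hD.2 j
      have hνS : MassBound (bdry T) (ν.restrict S) := by
        intro f π hD
        obtain ⟨g, hg, hg0, hg1, hgS, hgl⟩ := exists_cutoff S hSc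
        have t1 := tendsto_cutoff hD.1 ν hSc.measurableSet hg hg0 hg1 hgl
        refine ge_of_tendsto' (t1.const_mul _) fun n => ?_
        have hD2 : InDomain (fun x => g n x * f x) π := ⟨(hg n).mul hD.1, hD.2⟩
        refine le_trans (le_of_eq ?_) (hνb _ _ hD2)
        congr 1
        refine hcong _ _ _ _ ⟨isLipBdd_const 1, hcons hD⟩ ⟨isLipBdd_const 1, hcons hD2⟩
          (fun _ _ => rfl) (fun i => ?_)
        refine Fin.cases ?_ (fun j => ?_) i
        · intro x hx
          simp [hgS n x hx]
        · intro x hx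
          rfl
      obtain ⟨ν', hf', ht', hm', -⟩ := exists_pullback hS hSA (ν.restrict S) (by
        rw [Measure.restrict_apply hSc.measurableSet.compl]; simp)
      refine ⟨ν', hf', ht', transfer_bound hνS hm' ?_⟩
      intro f π hD
      have hD' := extF_dom hD
      have hcl : ∀ i, IsLip ((Fin.cons f π : Fin (k+1) → A → ℝ) i) := by
        intro i
        refine Fin.cases ?_ (fun j => ?_) i
        · exact hD.1.1
        · exact hD.2 j
      refine hcong _ _ _ _ ⟨extF_bdd (isLipBdd_const 1), fun i => extF_isLip (hcl i)⟩
        ⟨isLipBdd_const 1, hcons hD'⟩ ?_ (fun i => ?_)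
      · intro x hx
        rw [extF_mem (isLip_const 1) (hSA hx)]
      · refine Fin.cases ?_ (fun j => ?_) i
        · intro x hx; rfl
        · intro x hx; rfl
  · -- compact support
    have hpre : IsCompact ((Subtype.val : A → X) ⁻¹' S) :=
      Topology.IsInducing.subtypeVal.isCompact_preimage' hS (by simpa using hSA)
    exact hpre.of_isClosed_subset (isClosed_msupport _)
      (msupport_subset (massMeasure_le hb') hpre.isClosed h0')
  · intro f π hD
    have hD' : InDomain (f ∘ (Subtype.val : A → X)) (fun i => π i ∘ (Subtype.val : A → X)) :=
      ⟨hD.1.comp_val, fun i => (hD.2 i).comp_val⟩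
    refine hcong _ _ _ _ (extF_dom hD') hD ?_ ?_
    · intro x hx
      rw [extF_mem hD'.1.1 (hSA hx)]; rfl
    · intro i x hx
      rw [extF_mem (hD'.2 i) (hSA hx)]; rfl

end main

/-- For a subset `A ⊆ X` with inclusion `ι : A → X` and `T ∈ N_k^c(X)`:
`T ∈ ι_#(N_k^c(A))` if and only if `spt(T) ⊆ A`. -/
theorem memNkc_image_iff_spt_subset {X : Type*} [MetricSpace X] [MeasurableSpace X]
    [BorelSpace X] {k : ℕ} (A : Set X) (T : Func X k) (hT : MemNkc T) :
    (∃ T' : Func A k, MemNkc T' ∧ DkEq (pushF (Subtype.val : A → X) T') T) ↔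
      msupport (massMeasure T) ⊆ A := by
  exact ⟨fun ⟨T', h1, h2⟩ => forward A T T' h1 h2, fun h => backward A T hT h⟩
end
end
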